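/- arXiv:2504.10622 — 12 statements merged into one kernel-verified Lean document; each statement's English description precedes it below -/
import Mathlib

section
/- Let G : ℝ → ℝ be convex and nondecreasing, let N be a natural number, let a_1 ≤ a_2 ≤ … ≤ a_N and d_1 ≤ d_2 ≤ … ≤ d_N be real numbers, and let σ be a permutation of {1,…,N}. Then ∑_{j=1}^N G(d_j − a_j) ≤ ∑_{j=1}^N G(d_{σ(j)} − a_j). -/
theorem ConvexOn.exchange_sub_le {G : ℝ → ℝ} (hG : ConvexOn ℝ Set.univ G) {a a' d d' : ℝ}
    (ha : a ≤ a') (hd : d ≤ d') :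
    G (d - a) + G (d' - a') ≤ G (d' - a) + G (d - a') := by
  rcases ha.eq_or_lt with rfl | ha
  · linarith
  have hpos : 0 < (d' - d) + (a' - a) := by linarith
  set t := (d' - d) / ((d' - d) + (a' - a)) with ht
  have ht0 : 0 ≤ t := div_nonneg (by linarith) hpos.le
  have ht1 : 0 ≤ 1 - t := sub_nonneg.2 ((div_le_one hpos).2 (by linarith))
  have hmul : t * ((d' - d) + (a' - a)) = d' - d := div_mul_cancel₀ _ hpos.ne'
  have h₁ := hG.2 (Set.mem_univ (d - a')) (Set.mem_univ (d' - a)) ht0 ht1 (by ring)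
  have h₂ := hG.2 (Set.mem_univ (d - a')) (Set.mem_univ (d' - a)) ht1 ht0 (by ring)
  simp only [smul_eq_mul] at h₁ h₂
  rw [show t * (d - a') + (1 - t) * (d' - a) = d - a by linear_combination -hmul] at h₁
  rw [show (1 - t) * (d - a') + t * (d' - a) = d' - a' by linear_combination hmul] at h₂
  linarith

theorem Finset.sum_diag_le_sum_comp_perm {ι : Type*} [LinearOrder ι] (c : ι → ι → ℝ)
    (hc : ∀ i i' k k', i ≤ i' → k ≤ k' → c i k + c i' k' ≤ c i k' + c i' k)
    (s : Finset ι) (σ : Equiv.Perm ι) (hσ : ∀ x, σ x ≠ x → x ∈ s) :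
    ∑ j ∈ s, c j j ≤ ∑ j ∈ s, c j (σ j) := by
  induction s using Finset.induction_on_max generalizing σ with
  | empty => simp
  | insert m s hm ih =>
    have hms : m ∉ s := fun h => (hm m h).false
    rw [Finset.sum_insert hms, Finset.sum_insert hms]
    by_cases hfix : σ m = m
    · rw [hfix]
      refine add_le_add le_rfl (ih σ fun x hx => Finset.mem_of_mem_insert_of_ne (hσ x hx) ?_)
      rintro rfl
      exact hx hfix
    obtain ⟨p, hp⟩ := σ.surjective m
    have hpm : p ≠ m := by
      rintro rfl
      exact hfix hp
    have hps : p ∈ s := Finset.mem_of_mem_insert_of_ne (hσ p (hp ▸ hpm.symm)) hpm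
    have hqs : σ m ∈ s :=
      Finset.mem_of_mem_insert_of_ne (hσ _ fun h => hfix (σ.injective h)) hfix
    have hτ := ih (σ * Equiv.swap p m) fun x hx => by
      by_cases hxp : x = p
      · rwa [hxp]
      by_cases hxm : x = m
      · simp [hxm, hp] at hx
      rw [Equiv.Perm.mul_apply, Equiv.swap_apply_of_ne_of_ne hxp hxm] at hx
      exact Finset.mem_of_mem_insert_of_ne (hσ x hx) hxm
    have hrest : ∑ j ∈ s.erase p, c j ((σ * Equiv.swap p m) j) = ∑ j ∈ s.erase p, c j (σ j) := by
      refine Finset.sum_congr rfl fun j hj => ?_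
      rw [Equiv.Perm.mul_apply, Equiv.swap_apply_of_ne_of_ne (Finset.ne_of_mem_erase hj)
        (hm j (Finset.mem_of_mem_erase hj)).ne]
    rw [← Finset.add_sum_erase s (fun j => c j ((σ * Equiv.swap p m) j)) hps, hrest,
      Equiv.Perm.mul_apply, Equiv.swap_apply_left] at hτ
    rw [← Finset.add_sum_erase s (fun j => c j (σ j)) hps, hp]
    linarith [hc p m (σ m) m (hm p hps).le (hm _ hqs).le]

/-- Exchange inequality behind FCFS optimality (paper's Lemma 3.1): for a convex
nondecreasing `G`, sorted arrivals `a` and sorted departures `d`, matching them in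
order minimizes the total accumulated cost over all permutations `σ`. -/
theorem fcfs_exchange_inequality
    (G : ℝ → ℝ) (hG_convex : ConvexOn ℝ Set.univ G) (hG_mono : Monotone G)
    (N : ℕ) (a d : Fin N → ℝ) (ha : Monotone a) (hd : Monotone d)
    (σ : Equiv.Perm (Fin N)) :
    ∑ j : Fin N, G (d j - a j) ≤ ∑ j : Fin N, G (d (σ j) - a j) := by
  exact Finset.sum_diag_le_sum_comp_perm (fun i k => G (d k - a i))
    (fun _ _ _ _ hi hk => hG_convex.exchange_sub_le (ha hi) (hd hk))
    Finset.univ σ fun x _ => Finset.mem_univ x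
end

section
/- Let θ > 0, x₀ ∈ ℝ, and let f : ℝ → ℝ be continuously differentiable on [x₀, ∞) with ∫_0^∞ |f'(x₀+t)| e^{−θt} dt < ∞. Then t ↦ f(x₀+t)θe^{−θt} is integrable on [0,∞) and ∫_0^∞ f(x₀+t) θe^{−θt} dt − f(x₀) = (1/θ) ∫_0^∞ f'(x₀+t) θe^{−θt} dt. -/
open MeasureTheory Real Set

theorem hasDerivAt_mul_exp_neg_mul {g : ℝ → ℝ} {g' t : ℝ} (θ : ℝ) (hg : HasDerivAt g g' t) :
    HasDerivAt (fun t => g t * exp (-θ * t))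
      (g' * exp (-θ * t) - θ * (g t * exp (-θ * t))) t := by
  have h : HasDerivAt (fun t => exp (-θ * t)) (exp (-θ * t) * (-θ * 1)) t :=
    ((hasDerivAt_id t).const_mul (-θ)).exp
  exact (hg.mul h).congr_deriv (by ring)

theorem abs_le_sqrt_one_add_sq (x : ℝ) : |x| ≤ √(1 + x ^ 2) :=
  Real.abs_le_sqrt (by linarith)

/-- If the derivative of `g` is integrable against `exp (-θ t)`, then so is `g`. -/
theorem integrableOn_mul_exp_of_deriv {θ : ℝ} (hθ : 0 < θ) {g g' : ℝ → ℝ}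
    (hg : ContinuousOn g (Ici 0)) (hderiv : ∀ t ∈ Ioi 0, HasDerivAt g (g' t) t)
    (hg' : ContinuousOn g' (Ici 0))
    (hint : IntegrableOn (fun t => |g' t| * exp (-θ * t)) (Ioi 0)) :
    IntegrableOn (fun t => g t * exp (-θ * t)) (Ioi 0) := by
  have hpos (x : ℝ) : 0 < √(1 + x ^ 2) := Real.sqrt_pos.2 (by positivity)
  -- a smooth majorant of `|g|` whose derivative is dominated by `|g'|`
  set s : ℝ → ℝ := fun t => √(1 + g t ^ 2) with hs
  set s' : ℝ → ℝ := fun t => g t * g' t / s t with hs'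
  have hsc : ContinuousOn s (Ici 0) := by fun_prop
  have hs'c : ContinuousOn s' (Ici 0) := (hg.mul hg').div hsc fun t _ => (hpos _).ne'
  have hsd : ∀ t ∈ Ioi (0 : ℝ), HasDerivAt s (s' t) t := fun t ht => by
    have h := (((hderiv t ht).pow 2).const_add 1).sqrt
      (by simp only [Pi.pow_apply]; positivity)
    refine h.congr_deriv ?_
    simp only [hs', hs, Pi.pow_apply]
    have := (hpos (g t)).ne'
    field_simp
    norm_num
    ring
  have hs'le (t : ℝ) : s' t ≤ |g' t| := by
    refine (div_le_iff₀ (hpos _)).2 ((le_abs_self _).trans ?_)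
    rw [abs_mul, mul_comm]
    exact mul_le_mul_of_nonneg_left (abs_le_sqrt_one_add_sq _) (abs_nonneg _)
  have hexp : ContinuousOn (fun t => exp (-θ * t)) (Ici 0) := by fun_prop
  have hsec : ContinuousOn (fun t => s t * exp (-θ * t)) (Ici 0) := hsc.mul hexp
  have hs'ec : ContinuousOn (fun t => s' t * exp (-θ * t)) (Ici 0) := hs'c.mul hexp
  have hii {u : ℝ → ℝ} (hu : ContinuousOn u (Ici 0)) {T : ℝ} (hT : 0 ≤ T) :
      IntervalIntegrable u volume 0 T :=
    (hu.mono fun x hx => by rw [uIcc_of_le hT] at hx; exact hx.1).intervalIntegrable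
  have hsint : IntegrableOn (fun t => s t * exp (-θ * t)) (Ioi 0) := by
    refine integrableOn_Ioi_of_intervalIntegral_norm_bounded
      ((s 0 + ∫ t in Ioi (0 : ℝ), |g' t| * exp (-θ * t)) / θ) 0 (b := id)
      (l := Filter.atTop) (fun T => ?_) Filter.tendsto_id ?_
    · exact ((hsec.mono Icc_subset_Ici_self).integrableOn_Icc).mono_set Ioc_subset_Icc_self
    · filter_upwards [Filter.eventually_ge_atTop (0 : ℝ)] with T hT
      have hnorm : ∀ t, ‖s t * exp (-θ * t)‖ = s t * exp (-θ * t) := fun t =>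
        Real.norm_of_nonneg (mul_nonneg (hpos _).le (exp_pos _).le)
      simp only [hnorm, id]
      rw [le_div_iff₀ hθ]
      have hftc := intervalIntegral.integral_eq_sub_of_hasDerivAt_of_le hT
        (hsec.mono Icc_subset_Ici_self)
        (fun t ht => hasDerivAt_mul_exp_neg_mul θ (hsd t ht.1))
        ((hii hs'ec hT).sub ((hii hsec hT).const_mul θ))
      rw [intervalIntegral.integral_sub (hii hs'ec hT) ((hii hsec hT).const_mul θ),
        intervalIntegral.integral_const_mul] at hftc
      have hle : ∫ t in (0 : ℝ)..T, s' t * exp (-θ * t)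
          ≤ ∫ t in (0 : ℝ)..T, |g' t| * exp (-θ * t) :=
        intervalIntegral.integral_mono_on hT (hii hs'ec hT) (hii (hg'.abs.mul hexp) hT)
          fun t _ => mul_le_mul_of_nonneg_right (hs'le t) (exp_pos _).le
      have hle' : ∫ t in (0 : ℝ)..T, |g' t| * exp (-θ * t)
          ≤ ∫ t in Ioi (0 : ℝ), |g' t| * exp (-θ * t) := by
        rw [intervalIntegral.integral_of_le hT]
        exact setIntegral_mono_set hint (ae_of_all _ fun t => by positivity)
          (Ioc_subset_Ioi_self.eventuallyLE)
      have hend : 0 ≤ s T * exp (-θ * T) := mul_nonneg (hpos _).le (exp_pos _).le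
      simp only [mul_zero, exp_zero, mul_one] at hftc
      linarith
  refine hsint.mono'
    (((hg.mul hexp).mono Ioi_subset_Ici_self).aestronglyMeasurable measurableSet_Ioi)
    (ae_of_all _ fun t => ?_)
  rw [norm_mul, Real.norm_of_nonneg (exp_pos _).le]
  exact mul_le_mul_of_nonneg_right (abs_le_sqrt_one_add_sq _) (exp_pos _).le

/-- Integration by parts against `exp (-θ t)` on the half-line. -/
theorem integral_deriv_mul_exp_eq {θ : ℝ} (hθ : 0 < θ) {g g' : ℝ → ℝ}
    (hg : ContinuousOn g (Ici 0)) (hderiv : ∀ t ∈ Ioi 0, HasDerivAt g (g' t) t)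
    (hg' : ContinuousOn g' (Ici 0))
    (hint : IntegrableOn (fun t => |g' t| * exp (-θ * t)) (Ioi 0)) :
    ∫ t in Ioi (0 : ℝ), g' t * exp (-θ * t)
      = θ * (∫ t in Ioi (0 : ℝ), g t * exp (-θ * t)) - g 0 := by
  have hgint := integrableOn_mul_exp_of_deriv hθ hg hderiv hg' hint
  have hexp : ContinuousOn (fun t => exp (-θ * t)) (Ici 0) := by fun_prop
  have hg'int : IntegrableOn (fun t => g' t * exp (-θ * t)) (Ioi 0) :=
    hint.mono'
      (((hg'.mul hexp).mono Ioi_subset_Ici_self).aestronglyMeasurable measurableSet_Ioi)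
      (ae_of_all _ fun t => by simp)
  have hd : ∀ t ∈ Ioi (0 : ℝ), HasDerivAt (fun t => g t * exp (-θ * t))
      (g' t * exp (-θ * t) - θ * (g t * exp (-θ * t))) t :=
    fun t ht => hasDerivAt_mul_exp_neg_mul θ (hderiv t ht)
  have hdint := hg'int.sub (hgint.const_mul θ)
  have h := integral_Ioi_of_hasDerivAt_of_tendsto ((hg.mul hexp) 0 self_mem_Ici) hd hdint
    (tendsto_zero_of_hasDerivAt_of_integrableOn_Ioi hd hdint hgint)
  rw [integral_sub hg'int (hgint.const_mul θ), integral_const_mul] at h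
  simp only [Pi.mul_apply, mul_zero, exp_zero, mul_one] at h
  linarith


/-- Forward half of the paper's Lemma 4.4: for `X ~ Exp(θ)`,
`E[f(x₀+X)] − f(x₀) = E[X]·E[f'(x₀+X)]`, writing the expectations as integrals
against the density `θe^{−θt}` on `[0,∞)`. -/
theorem exp_shift_forward
    (θ : ℝ) (hθ : 0 < θ) (x₀ : ℝ) (f f' : ℝ → ℝ)
    (hderiv : ∀ x ∈ Ici x₀, HasDerivWithinAt f (f' x) (Ici x₀) x)
    (hcont : ContinuousOn f' (Ici x₀))
    (hint : IntegrableOn (fun t => |f' (x₀ + t)| * exp (-θ * t)) (Ici 0)) :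
    IntegrableOn (fun t => f (x₀ + t) * (θ * exp (-θ * t))) (Ici 0) ∧
    (∫ t in Ici (0:ℝ), f (x₀ + t) * (θ * exp (-θ * t))) - f x₀ =
      (1 / θ) * ∫ t in Ici (0:ℝ), f' (x₀ + t) * (θ * exp (-θ * t)) := by
  have hmaps : MapsTo (fun t => x₀ + t) (Ici 0) (Ici x₀) := fun t ht =>
    mem_Ici.2 (le_add_of_nonneg_right ht)
  have hg : ContinuousOn (fun t => f (x₀ + t)) (Ici 0) :=
    ContinuousOn.comp (fun x hx => (hderiv x hx).continuousWithinAt) (by fun_prop) hmaps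
  have hg' : ContinuousOn (fun t => f' (x₀ + t)) (Ici 0) := hcont.comp (by fun_prop) hmaps
  have hd : ∀ t ∈ Ioi (0 : ℝ), HasDerivAt (fun t => f (x₀ + t)) (f' (x₀ + t)) t := fun t ht => by
    have hlt : x₀ < x₀ + t := lt_add_of_pos_right _ ht
    exact ((hderiv _ hlt.le).hasDerivAt (Ici_mem_nhds hlt)).comp_const_add x₀ t
  rw [integrableOn_Ici_iff_integrableOn_Ioi] at hint ⊢
  simp only [integral_Ici_eq_integral_Ioi, mul_left_comm _ θ, integral_const_mul]
  refine ⟨(integrableOn_mul_exp_of_deriv hθ hg hd hg' hint).const_mul θ, ?_⟩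
  rw [integral_deriv_mul_exp_eq hθ hg hd hg' hint, add_zero]
  field_simp
end

section
/- Let θ > 0, x₀ ∈ ℝ, and let f : ℝ → ℝ be continuously differentiable on (−∞, x₀] with ∫_0^∞ |f'(x₀−t)| e^{−θt} dt < ∞ and ∫_0^∞ |f(x₀−t)| θe^{−θt} dt < ∞. Then f(x₀) − ∫_0^∞ f(x₀−t) θe^{−θt} dt = (1/θ) ∫_0^∞ f'(x₀−t) θe^{−θt} dt. -/
open MeasureTheory Real Set

/-- Backward half of the paper's Lemma 4.4: for `X ~ Exp(θ)`,
`f(x₀) − E[f(x₀−X)] = E[X]·E[f'(x₀−X)]`, writing the expectations as integrals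
against the density `θe^{−θt}` on `[0,∞)`. -/
theorem exp_shift_backward
    (θ : ℝ) (hθ : 0 < θ) (x₀ : ℝ) (f f' : ℝ → ℝ)
    (hderiv : ∀ x ∈ Iic x₀, HasDerivWithinAt f (f' x) (Iic x₀) x)
    (hcont : ContinuousOn f' (Iic x₀))
    (hint' : IntegrableOn (fun t => |f' (x₀ - t)| * exp (-θ * t)) (Ici 0))
    (hint : IntegrableOn (fun t => |f (x₀ - t)| * (θ * exp (-θ * t))) (Ici 0)) :
    f x₀ - (∫ t in Ici (0:ℝ), f (x₀ - t) * (θ * exp (-θ * t))) =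
      (1 / θ) * ∫ t in Ici (0:ℝ), f' (x₀ - t) * (θ * exp (-θ * t)) := by
  have hmaps : MapsTo (fun t => x₀ - t) (Ici 0) (Iic x₀) := fun t ht => by
    simpa using ht
  have hshift : ContinuousOn (fun t : ℝ => x₀ - t) (Ici 0) := by fun_prop
  have hfc : ContinuousOn (fun t => f (x₀ - t)) (Ici 0) :=
    ContinuousOn.comp (fun x hx => (hderiv x hx).continuousWithinAt) hshift hmaps
  have hfc' : ContinuousOn (fun t => f' (x₀ - t)) (Ici 0) := hcont.comp hshift hmaps
  have hexp : ContinuousOn (fun t => exp (-θ * t)) (Ici 0) := by fun_prop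
  have hf' : IntegrableOn (fun t => f' (x₀ - t) * exp (-θ * t)) (Ici 0) := by
    refine Integrable.mono hint' ((hfc'.mul hexp).aestronglyMeasurable measurableSet_Ici)
      (.of_forall fun t => ?_)
    simp
  have hf : IntegrableOn (fun t => f (x₀ - t) * (θ * exp (-θ * t))) (Ici 0) := by
    refine Integrable.mono hint
      ((hfc.mul (hexp.const_mul θ)).aestronglyMeasurable measurableSet_Ici)
      (.of_forall fun t => ?_)
    simp
  have hG : IntegrableOn (fun t => f (x₀ - t) * exp (-θ * t)) (Ici 0) := by
    refine (hf.const_mul θ⁻¹).congr (.of_forall fun t => ?_)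
    field_simp
  have hGderiv : ∀ t ∈ Ioi (0 : ℝ), HasDerivAt (fun t => f (x₀ - t) * exp (-θ * t))
      (-(f' (x₀ - t) * exp (-θ * t)) - f (x₀ - t) * (θ * exp (-θ * t))) t := fun t ht => by
    have hlt : x₀ - t < x₀ := by simpa using ht
    have h₁ : HasDerivAt (fun t => f (x₀ - t)) (-f' (x₀ - t)) t := by
      simpa using ((hderiv _ hlt.le).hasDerivAt (Iic_mem_nhds hlt)).comp_const_sub x₀ t
    have h₂ : HasDerivAt (fun t => exp (-θ * t)) (exp (-θ * t) * -θ) t := by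
      simpa using ((hasDerivAt_id t).const_mul (-θ)).exp
    exact (h₁.mul h₂).congr_deriv (by ring)
  have hsub : Ioi (0 : ℝ) ⊆ Ici 0 := Ioi_subset_Ici_self
  have hG' := (hf'.mono_set hsub).neg.sub (hf.mono_set hsub)
  have key :
      ∫ t in Ioi (0 : ℝ), (-(f' (x₀ - t) * exp (-θ * t)) - f (x₀ - t) * (θ * exp (-θ * t))) =
        0 - f (x₀ - 0) * exp (-θ * 0) := integral_Ioi_of_hasDerivAt_of_tendsto
    ((hfc.mul hexp) 0 self_mem_Ici) hGderiv hG'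
    (tendsto_zero_of_hasDerivAt_of_integrableOn_Ioi hGderiv hG' (hG.mono_set hsub))
  have hsplit := integral_sub (hf'.mono_set hsub).neg (hf.mono_set hsub)
  simp only [Pi.neg_apply, integral_neg] at hsplit
  rw [hsplit] at key
  have hscale : (1 / θ) * ∫ t in Ioi (0 : ℝ), f' (x₀ - t) * (θ * exp (-θ * t)) =
      ∫ t in Ioi (0 : ℝ), f' (x₀ - t) * exp (-θ * t) := by
    rw [← integral_const_mul]
    congr 1 with t
    field_simp
  rw [integral_Ici_eq_integral_Ioi, integral_Ici_eq_integral_Ioi, hscale]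
  simp only [sub_zero, mul_zero, exp_zero, mul_one] at key
  linarith
end

section
/- Let λ, α > 0, t ∈ ℝ, and let r : ℝ → [0,∞] be measurable. Then ∫_0^∞ λe^{−λx} ( ∫_0^x α r(t−x+s) e^{−αs} ds ) dx = (α/(α+λ)) ∫_0^∞ λ e^{−λy} r(t−y) dy, as an equality in [0,∞]. -/
open MeasureTheory Real Set

/-- The total mass of a multiple of an exponential density, as an integral in `[0,∞]`. -/
lemma lintegral_const_mul_exp_neg_mul_Ioi {a b : ℝ} (ha : 0 < a) (hb : 0 < b) :
    ∫⁻ s in Ioi (0:ℝ), ENNReal.ofReal (a * exp (-b * s)) = ENNReal.ofReal (a / b) := by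
  have hb' : -b < 0 := neg_lt_zero.mpr hb
  rw [← ofReal_integral_eq_lintegral_ofReal ((integrableOn_exp_mul_Ioi hb' 0).const_mul a)
    (.of_forall fun s => by positivity), integral_const_mul, integral_exp_mul_Ioi hb']
  congr 1
  simp [div_eq_mul_inv]

/-- The integral of a convolution is the product of the integrals, in `[0,∞]`. -/
lemma lintegral_lintegral_mul_sub {A B : ℝ → ENNReal} (hA : Measurable A) (hB : Measurable B) :
    ∫⁻ x, ∫⁻ s, A s * B (x - s) = (∫⁻ s, A s) * ∫⁻ y, B y := by
  rw [lintegral_lintegral_swap (by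
    apply Measurable.aemeasurable
    change Measurable fun p : ℝ × ℝ => A p.2 * B (p.1 - p.2)
    fun_prop), ← lintegral_mul_const _ hA]
  refine lintegral_congr fun s => ?_
  rw [lintegral_const_mul _ (by fun_prop), lintegral_sub_right_eq_self]

/-- Paper's Lemma 4.9: `Γ(t,α) := E[∫_0^{T₂} α r(t−T₂+s)e^{−αs} ds]` for
`T₂ ~ Exp(λ)` equals `(α/(α+λ))·E[r(t−T₂)]`, as an identity in `[0,∞]`. -/
theorem gamma_formula
    (lam alpha t : ℝ) (hlam : 0 < lam) (halpha : 0 < alpha)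
    (r : ℝ → ENNReal) (hr : Measurable r) :
    (∫⁻ x in Ioi (0:ℝ), ENNReal.ofReal (lam * exp (-lam * x)) *
        ∫⁻ s in Ioc (0:ℝ) x, ENNReal.ofReal (alpha * exp (-alpha * s)) * r (t - x + s)) =
      ENNReal.ofReal (alpha / (alpha + lam)) *
        ∫⁻ y in Ioi (0:ℝ), ENNReal.ofReal (lam * exp (-lam * y)) * r (t - y) := by
  have hA : Measurable fun s => ENNReal.ofReal (alpha * exp (-(alpha + lam) * s)) := by fun_prop
  have hB : Measurable fun y => ENNReal.ofReal (lam * exp (-lam * y)) * r (t - y) := by fun_prop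
  rw [← lintegral_const_mul_exp_neg_mul_Ioi halpha (add_pos halpha hlam),
    setLIntegral_congr (Ioi_ae_eq_Ici (μ := volume) (a := (0:ℝ))) (f := fun y =>
      ENNReal.ofReal (lam * exp (-lam * y)) * r (t - y)),
    ← lintegral_indicator measurableSet_Ioi, ← lintegral_indicator measurableSet_Ioi,
    ← lintegral_indicator measurableSet_Ici,
    ← lintegral_lintegral_mul_sub (hA.indicator measurableSet_Ioi) (hB.indicator measurableSet_Ici)]
  refine lintegral_congr fun x => ?_
  by_cases hx : 0 < x
  · rw [indicator_of_mem (mem_Ioi.mpr hx), ← lintegral_const_mul _ (by fun_prop),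
      ← lintegral_indicator measurableSet_Ioc]
    refine lintegral_congr fun s => ?_
    by_cases hs : 0 < s <;> by_cases hsx : s ≤ x <;> simp only [indicator, mem_Ioc, mem_Ioi,
      mem_Ici, sub_nonneg, hs, hsx, and_self, and_true, and_false, if_true, if_false,
      zero_mul, mul_zero]
    rw [← mul_assoc, ← mul_assoc, ← ENNReal.ofReal_mul (by positivity),
      ← ENNReal.ofReal_mul (by positivity), sub_sub_eq_add_sub, add_sub_right_comm]
    congr 2
    rw [mul_mul_mul_comm, mul_mul_mul_comm alpha, ← exp_add, ← exp_add, mul_comm lam]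
    congr 2
    ring
  · rw [indicator_of_notMem (by simpa using hx), ← lintegral_zero (μ := volume) (α := ℝ)]
    refine lintegral_congr fun s => ?_
    by_cases hs : 0 < s
    · have hsx : x - s < 0 := by linarith
      simp [indicator, hsx.not_ge]
    · simp [indicator, hs]
end

section
/- Let λ > 0 and let c : [0,∞) → ℝ be continuous; define r : ℝ → ℝ by r(t) := c(t) + λ∫_0^t c(x)dx for t ≥ 0 and r(t) := 0 for t < 0. Then for every t ≥ 0, ∫_0^∞ λ e^{−λy} r(t−y) dy = r(t) − c(t). -/
open MeasureTheory Real Set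

/-- Equation (7) of the paper's Lemma 4.10: with
`r(t) = c(t) + λ∫_0^t c` for `t ≥ 0` and `r(t) = 0` for `t < 0`,
one has `E[r(t−T₂)] = r(t) − c(t)` for `T₂ ~ Exp(λ)`. -/
theorem expectation_r_shift_down
    (lam : ℝ) (hlam : 0 < lam)
    (c : ℝ → ℝ) (hc : ContinuousOn c (Ici 0))
    (r : ℝ → ℝ)
    (hr : ∀ u, r u = if 0 ≤ u then c u + lam * ∫ x in (0:ℝ)..u, c x else 0)
    (t : ℝ) (ht : 0 ≤ t) :
    ∫ y in Ioi (0:ℝ), lam * exp (-lam * y) * r (t - y) = r t - c t := by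
  set d : ℝ → ℝ := fun x => c (max x 0) with hd
  have hd_cont : Continuous d :=
    hc.comp_continuous (by fun_prop) fun x => le_max_right x 0
  have hC (u : ℝ) (hu : 0 ≤ u) : ∫ x in (0:ℝ)..u, c x = ∫ x in (0:ℝ)..u, d x := by
    refine intervalIntegral.integral_congr fun x hx => ?_
    rw [uIcc_of_le hu] at hx
    simp [hd, max_eq_left hx.1]
  have hr_nonneg (u : ℝ) (hu : 0 ≤ u) : r u = d u + lam * ∫ x in (0:ℝ)..u, d x := by
    rw [hr, if_pos hu, hC u hu]
    simp [hd, max_eq_left hu]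
  have hD (u : ℝ) : HasDerivAt (fun v => ∫ x in (0:ℝ)..v, d x) (d u) u :=
    hd_cont.integral_hasStrictDerivAt 0 u |>.hasDerivAt
  have hD_cont : Continuous fun v => ∫ x in (0:ℝ)..v, d x :=
    continuous_iff_continuousAt.2 fun u => (hD u).continuousAt
  have hF (y : ℝ) : HasDerivAt (fun y => -lam * exp (-lam * y) * ∫ x in (0:ℝ)..(t - y), d x)
      (lam * exp (-lam * y) * (d (t - y) + lam * ∫ x in (0:ℝ)..(t - y), d x)) y := by
    have h_exp : HasDerivAt (fun y => -lam * exp (-lam * y))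
        (-lam * (exp (-lam * y) * (-lam * 1))) y :=
      (((hasDerivAt_id y).const_mul (-lam)).exp).const_mul (-lam)
    have h_int := (hD (t - y)).comp y ((hasDerivAt_id y).const_sub t)
    exact (h_exp.mul h_int).congr_deriv (by simp only [Function.comp_apply]; ring)
  calc ∫ y in Ioi (0:ℝ), lam * exp (-lam * y) * r (t - y)
      = ∫ y in Ioc 0 t, lam * exp (-lam * y) * r (t - y) := by
        refine setIntegral_eq_of_subset_of_forall_sdiff_eq_zero measurableSet_Ioi
          Ioc_subset_Ioi_self fun y hy => ?_
        have h_lt : t < y := not_le.1 fun h => hy.2 ⟨hy.1, h⟩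
        rw [hr, if_neg (by linarith), mul_zero]
    _ = ∫ y in (0:ℝ)..t,
          lam * exp (-lam * y) * (d (t - y) + lam * ∫ x in (0:ℝ)..(t - y), d x) := by
        rw [intervalIntegral.integral_of_le ht]
        refine setIntegral_congr_fun measurableSet_Ioc fun y hy => ?_
        simp only [hr_nonneg (t - y) (sub_nonneg.2 hy.2)]
    _ = r t - c t := by
        rw [intervalIntegral.integral_eq_sub_of_hasDerivAt (fun y _ => hF y)
          (Continuous.intervalIntegrable (by fun_prop) _ _), hr, if_pos ht, hC t ht]
        simp
end

section
/- Let λ, μ, α > 0, let γ ∈ (0,1) satisfy γ·(μ + α + λ − λγ) = μ, and set θ := α/(1−γ). Let c : [0,∞) → ℝ be continuously differentiable and nondecreasing with ∫_0^∞ c(u) e^{−θu} du < ∞. Then for every t ≥ 0, ∫_0^∞ ( c'(t+x) + λ c(t+x) ) θe^{−θx} dx = (μ/γ) ∫_0^∞ c(t+x) θe^{−θx} dx − (α/(1−γ)) c(t). -/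
open MeasureTheory Real Set

/-- A monotone function whose exponentially damped version is integrable on `(0, ∞)` is
`o(exp (θ x))` at infinity. -/
theorem tendsto_mul_exp_neg_of_monotone {θ : ℝ} (hθ : 0 < θ) {g : ℝ → ℝ} (hg : Monotone g)
    (hint : IntegrableOn (fun x => g x * exp (-θ * x)) (Ioi 0)) :
    Filter.Tendsto (fun x => g x * exp (-θ * x)) Filter.atTop (nhds 0) := by
  have hexp : Filter.Tendsto (fun x => exp (-θ * x)) Filter.atTop (nhds 0) :=
    tendsto_exp_atBot.comp
      (Filter.tendsto_id.const_mul_atTop_of_neg (neg_lt_zero.mpr hθ))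
  have hlow : Filter.Tendsto (fun x => g 0 * exp (-θ * x)) Filter.atTop (nhds 0) := by
    simpa using hexp.const_mul (g 0)
  have hup : Filter.Tendsto
      (fun x => θ * ((∫ u in Ioi (0:ℝ), g u * exp (-θ * u)) - ∫ u in (0:ℝ)..x, g u * exp (-θ * u)))
      Filter.atTop (nhds 0) := by
    simpa using
      ((intervalIntegral_tendsto_integral_Ioi 0 hint Filter.tendsto_id).const_sub
        (∫ u in Ioi (0:ℝ), g u * exp (-θ * u))).const_mul θ
  refine tendsto_of_tendsto_of_tendsto_of_le_of_le' hlow hup ?_ ?_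
  · filter_upwards [Filter.eventually_ge_atTop 0] with x hx
    exact mul_le_mul_of_nonneg_right (hg hx) (exp_pos _).le
  · filter_upwards [Filter.eventually_ge_atTop 0] with x hx
    have hintx : IntegrableOn (fun u => g u * exp (-θ * u)) (Ioi x) :=
      hint.mono_set (Ioi_subset_Ioi hx)
    have hsplit := intervalIntegral.integral_interval_add_Ioi hint hintx
    have hle : ∫ u in Ioi x, g x * exp (-θ * u) ≤ ∫ u in Ioi x, g u * exp (-θ * u) :=
      setIntegral_mono_on ((integrableOn_exp_mul_Ioi (neg_lt_zero.mpr hθ) x).const_mul _) hintx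
        measurableSet_Ioi
        fun u hu => mul_le_mul_of_nonneg_right (hg (le_of_lt hu)) (exp_pos _).le
    rw [integral_const_mul, integral_exp_mul_Ioi (neg_lt_zero.mpr hθ)] at hle
    have htail : θ * (g x * (-exp (-θ * x) / -θ)) = g x * exp (-θ * x) := by
      field_simp
    rw [← hsplit, add_sub_cancel_left, ← htail]
    exact mul_le_mul_of_nonneg_left hle hθ.le

/-- Integration by parts against `exp (-θ x)` for the derivative of a monotone function. -/
theorem integral_deriv_mul_exp_neg_of_monotone {θ : ℝ} (hθ : 0 < θ) {g g' : ℝ → ℝ}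
    (hg : Monotone g) (hcont : Continuous g) (hderiv : ∀ x ∈ Ioi (0:ℝ), HasDerivAt g (g' x) x)
    (hint : IntegrableOn (fun x => g x * exp (-θ * x)) (Ioi 0)) :
    IntegrableOn (fun x => g' x * exp (-θ * x)) (Ioi 0) ∧
      ∫ x in Ioi (0:ℝ), g' x * exp (-θ * x) =
        θ * (∫ x in Ioi (0:ℝ), g x * exp (-θ * x)) - g 0 := by
  have hc : Continuous fun x => g x * exp (-θ * x) := by fun_prop
  have hprim (x : ℝ) : HasDerivAt (fun y => ∫ u in (0:ℝ)..y, g u * exp (-θ * u))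
      (g x * exp (-θ * x)) x := (hc.integral_hasStrictDerivAt 0 x).hasDerivAt
  let K : ℝ → ℝ := fun x => g x * exp (-θ * x) + θ * ∫ u in (0:ℝ)..x, g u * exp (-θ * u)
  have hKcont : ContinuousWithinAt K (Ici 0) 0 :=
    (hc.continuousAt.add ((hprim 0).continuousAt.const_mul θ)).continuousWithinAt
  have hK : ∀ x ∈ Ioi (0:ℝ), HasDerivAt K (g' x * exp (-θ * x)) x := by
    intro x hx
    have he : HasDerivAt (fun y => exp (-θ * y)) (exp (-θ * x) * (-θ * 1)) x :=
      ((hasDerivAt_id x).const_mul (-θ)).exp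
    refine (((hderiv x hx).mul he).add ((hprim x).const_mul θ)).congr_deriv ?_
    ring
  have hlim : Filter.Tendsto K Filter.atTop
      (nhds (0 + θ * ∫ x in Ioi (0:ℝ), g x * exp (-θ * x))) :=
    (tendsto_mul_exp_neg_of_monotone hθ hg hint).add
      ((intervalIntegral_tendsto_integral_Ioi 0 hint Filter.tendsto_id).const_mul θ)
  have hpos : ∀ x ∈ Ioi (0:ℝ), 0 ≤ g' x * exp (-θ * x) := fun x hx =>
    mul_nonneg ((hderiv x hx).deriv ▸ hg.deriv_nonneg) (exp_pos _).le
  have hI := integrableOn_Ioi_deriv_of_nonneg hKcont hK hpos hlim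
  refine ⟨hI, ?_⟩
  rw [integral_Ioi_of_hasDerivAt_of_tendsto hKcont hK hI hlim]
  simp [K]

/-- Equation (8) of the paper's Lemma 4.10: for `X ~ Exp(θ)` with
`θ = α/(1−γ)` and `γ` the M/M/1 busy-period transform,
`E[r'(t+X)] = (μ/γ)E[c(t+X)] − (α/(1−γ))c(t)`, where `r' = c' + λc`. -/
theorem expectation_r_deriv_shift_up
    (lam mu alpha gamma : ℝ) (hlam : 0 < lam) (hmu : 0 < mu) (halpha : 0 < alpha)
    (hg0 : 0 < gamma) (hg1 : gamma < 1)
    (hfix : gamma * (mu + alpha + lam - lam * gamma) = mu)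
    (θ : ℝ) (hθ : θ = alpha / (1 - gamma))
    (c c' : ℝ → ℝ)
    (hderiv : ∀ x ∈ Ici (0:ℝ), HasDerivWithinAt c (c' x) (Ici 0) x)
    (hc' : ContinuousOn c' (Ici 0))
    (hmono : MonotoneOn c (Ici 0))
    (hint : IntegrableOn (fun u => c u * exp (-θ * u)) (Ici 0))
    (t : ℝ) (ht : 0 ≤ t) :
    ∫ x in Ioi (0:ℝ), (c' (t + x) + lam * c (t + x)) * (θ * exp (-θ * x)) =
      mu / gamma * (∫ x in Ioi (0:ℝ), c (t + x) * (θ * exp (-θ * x)))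
        - alpha / (1 - gamma) * c t := by
  have h1g : 0 < 1 - gamma := sub_pos.mpr hg1
  have hθpos : 0 < θ := hθ ▸ div_pos halpha h1g
  have hrate : mu / gamma = θ + lam := by
    rw [hθ]
    field_simp
    linarith
  let g : ℝ → ℝ := fun x => c (t + max x 0)
  have hmem (x : ℝ) : t + max x 0 ∈ Ici (0:ℝ) := add_nonneg ht (le_max_right _ _)
  have hg_eq : ∀ x ∈ Ioi (0:ℝ), g x = c (t + x) := fun x hx => by
    simp only [g, max_eq_left (le_of_lt (mem_Ioi.mp hx))]
  have hg : Monotone g := fun x y hxy => hmono (hmem x) (hmem y) (by gcongr)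
  have hcont : Continuous g :=
    ContinuousOn.comp_continuous (fun x hx => (hderiv x hx).continuousWithinAt)
      (by fun_prop) hmem
  have hgderiv : ∀ x ∈ Ioi (0:ℝ), HasDerivAt g (c' (t + x)) x := by
    intro x hx
    have hpos : 0 < t + x := add_pos_of_nonneg_of_pos ht hx
    have hd := ((hderiv (t + x) hpos.le).hasDerivAt (Ici_mem_nhds hpos)).comp_const_add t x
    exact hd.congr_of_eventuallyEq (Filter.eventuallyEq_of_mem (Ioi_mem_nhds hx) hg_eq)
  have hshift : IntegrableOn (fun x => c (t + x) * exp (-θ * x)) (Ioi 0) := by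
    have hpre : IntegrableOn (fun x => c (t + x) * exp (-θ * (t + x))) (Ioi 0) := by
      have := ((measurePreserving_add_left volume t).integrableOn_comp_preimage
        (measurableEmbedding_addLeft t)).mpr
        (hint.mono_set (Ioi_subset_Ici ht : Ioi t ⊆ Ici 0))
      simpa [Function.comp_def] using this
    refine IntegrableOn.congr_fun (hpre.const_mul (exp (θ * t))) (fun x _ => ?_) measurableSet_Ioi
    have he : exp (-θ * x) = exp (θ * t) * exp (-θ * (t + x)) := by
      rw [← exp_add]
      ring_nf
    simp only [he]
    ring
  have hgint : IntegrableOn (fun x => g x * exp (-θ * x)) (Ioi 0) :=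
    hshift.congr_fun (fun x hx => by simp only [hg_eq x hx]) measurableSet_Ioi
  obtain ⟨hI, hparts⟩ := integral_deriv_mul_exp_neg_of_monotone hθpos hg hcont hgderiv hgint
  have hgI : ∫ x in Ioi (0:ℝ), g x * exp (-θ * x) = ∫ x in Ioi (0:ℝ), c (t + x) * exp (-θ * x) :=
    setIntegral_congr_fun measurableSet_Ioi fun x hx => by simp only [hg_eq x hx]
  have hgz : g 0 = c t := by simp [g]
  rw [hgI, hgz] at hparts
  have hleft : ∫ x in Ioi (0:ℝ), (c' (t + x) + lam * c (t + x)) * (θ * exp (-θ * x)) =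
      θ * ((∫ x in Ioi (0:ℝ), c' (t + x) * exp (-θ * x)) +
        lam * ∫ x in Ioi (0:ℝ), c (t + x) * exp (-θ * x)) := by
    rw [← integral_const_mul lam, ← integral_add hI (hshift.const_mul lam), ← integral_const_mul]
    congr 1 with x
    ring
  have hright : ∫ x in Ioi (0:ℝ), c (t + x) * (θ * exp (-θ * x)) =
      θ * ∫ x in Ioi (0:ℝ), c (t + x) * exp (-θ * x) := by
    rw [← integral_const_mul]
    congr 1 with x
    ring
  rw [hleft, hright, hparts, hrate, ← hθ]
  ring
end

section
/- Let λ, μ, α > 0, let γ ∈ (0,1) satisfy γ·(μ + α + λ − λγ) = μ, and set θ := α/(1−γ). Let c : [0,∞) → ℝ be continuously differentiable and nondecreasing with ∫_0^∞ c(u) e^{−θu} du < ∞, and define r(t) := c(t) + λ∫_0^t c(x)dx for t ≥ 0. Then for every t ≥ 0, ∫_0^∞ r(t+x) θe^{−θx} dx = r(t) − c(t) + (μ(1−γ)/(γα)) ∫_0^∞ c(t+x) θe^{−θx} dx. -/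
open MeasureTheory Real Set

theorem integral_exp_neg_mul_Ioi_zero {θ : ℝ} (hθ : 0 < θ) :
    ∫ x in Ioi (0:ℝ), exp (-θ * x) = θ⁻¹ := by
  rw [integral_exp_mul_Ioi (by linarith) 0]
  simp [neg_div_neg_eq]

/-- The Laplace transform of a primitive of `f`, as a product of Laplace transforms. -/
theorem integral_primitive_mul_exp_neg {θ : ℝ} (hθ : 0 < θ) {f : ℝ → ℝ}
    (hf : IntegrableOn (fun x => f x * exp (-θ * x)) (Ioi 0)) :
    IntegrableOn (fun x => (∫ s in (0:ℝ)..x, f s) * exp (-θ * x)) (Ioi 0) ∧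
      ∫ x in Ioi (0:ℝ), (∫ s in (0:ℝ)..x, f s) * exp (-θ * x) =
        (∫ x in Ioi (0:ℝ), f x * exp (-θ * x)) * θ⁻¹ := by
  have hexp : IntegrableOn (fun x : ℝ => exp (-θ * x)) (Ioi 0) :=
    integrableOn_exp_mul_Ioi (by linarith) 0
  have hval := integral_exp_neg_mul_Ioi_zero hθ
  have hconv (x : ℝ) : ∫ s in (0:ℝ)..x,
      ContinuousLinearMap.mul ℝ ℝ (f s * exp (-θ * s)) (exp (-θ * (x - s))) =
        (∫ s in (0:ℝ)..x, f s) * exp (-θ * x) := by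
    rw [← intervalIntegral.integral_mul_const]
    congr 1 with s
    rw [ContinuousLinearMap.mul_apply', mul_assoc, ← exp_add]
    ring_nf
  constructor
  · have h := integrable_posConvolution hf hexp (ContinuousLinearMap.mul ℝ ℝ)
    rw [← integrable_indicator_iff measurableSet_Ioi]
    simpa only [posConvolution, hconv] using h
  · have h := integral_posConvolution hf hexp (ContinuousLinearMap.mul ℝ ℝ)
    simp only [hconv] at h
    rwa [ContinuousLinearMap.mul_apply', hval] at h

/-- Equation (9) of the paper's Lemma 4.10: for `X ~ Exp(θ)` with
`θ = α/(1−γ)` and `γ` the M/M/1 busy-period transform,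
`E[r(t+X)] = r(t) − c(t) + (μ(1−γ)/(γα))E[c(t+X)]`,
where `r(t) = c(t) + λ∫_0^t c`. -/
theorem expectation_r_shift_up
    (lam mu alpha gamma : ℝ) (hlam : 0 < lam) (hmu : 0 < mu) (halpha : 0 < alpha)
    (hg0 : 0 < gamma) (hg1 : gamma < 1)
    (hfix : gamma * (mu + alpha + lam - lam * gamma) = mu)
    (θ : ℝ) (hθ : θ = alpha / (1 - gamma))
    (c c' : ℝ → ℝ)
    (hderiv : ∀ x ∈ Ici (0:ℝ), HasDerivWithinAt c (c' x) (Ici 0) x)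
    (hc' : ContinuousOn c' (Ici 0))
    (hmono : MonotoneOn c (Ici 0))
    (hint : IntegrableOn (fun u => c u * exp (-θ * u)) (Ici 0))
    (r : ℝ → ℝ)
    (hr : ∀ u ∈ Ici (0:ℝ), r u = c u + lam * ∫ x in (0:ℝ)..u, c x)
    (t : ℝ) (ht : 0 ≤ t) :
    ∫ x in Ioi (0:ℝ), r (t + x) * (θ * exp (-θ * x)) =
      r t - c t +
        mu * (1 - gamma) / (gamma * alpha) *
          ∫ x in Ioi (0:ℝ), c (t + x) * (θ * exp (-θ * x)) := by
  have hg : 0 < 1 - gamma := by linarith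
  have hθ0 : 0 < θ := hθ ▸ div_pos halpha hg
  have hcoef : mu * (1 - gamma) / (gamma * alpha) = 1 + lam * θ⁻¹ := by
    rw [hθ]
    field_simp
    linarith
  have hcont : ContinuousOn c (Ici 0) := fun x hx => (hderiv x hx).continuousWithinAt
  have hii {a b : ℝ} (ha : 0 ≤ a) (hb : 0 ≤ b) : IntervalIntegrable c volume a b :=
    (hcont.mono fun x hx => (le_min ha hb).trans hx.1).intervalIntegrable
  have hshift : IntegrableOn (fun x => c (t + x) * exp (-θ * x)) (Ioi 0) := by
    have h := (measurePreserving_add_left volume t).integrableOn_comp_preimage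
      (measurableEmbedding_addLeft t) |>.2 (hint.mono_set (Ioi_subset_Ici ht))
    rw [preimage_const_add_Ioi, sub_self] at h
    refine IntegrableOn.congr_fun (h.const_mul (exp (θ * t))) (fun x _ => ?_) measurableSet_Ioi
    simp only [Function.comp]
    rw [mul_left_comm, ← exp_add]
    ring_nf
  have hexp : IntegrableOn (fun x : ℝ => exp (-θ * x)) (Ioi 0) :=
    integrableOn_exp_mul_Ioi (by linarith) 0
  have hval := integral_exp_neg_mul_Ioi_zero hθ0
  obtain ⟨hpi, hpv⟩ := integral_primitive_mul_exp_neg hθ0 hshift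
  have hsplit : ∀ x ∈ Ioi (0:ℝ), r (t + x) * (θ * exp (-θ * x)) =
      θ * (c (t + x) * exp (-θ * x)) + (lam * θ * ∫ s in (0:ℝ)..t, c s) * exp (-θ * x) +
        lam * θ * ((∫ s in (0:ℝ)..x, c (t + s)) * exp (-θ * x)) := by
    intro x hx
    have hx0 : 0 ≤ x := le_of_lt hx
    rw [hr (t + x) (add_nonneg ht hx0), intervalIntegral.integral_comp_add_left c t, add_zero,
      ← intervalIntegral.integral_add_adjacent_intervals (hii le_rfl ht)
        (hii ht (add_nonneg ht hx0))]
    ring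
  have hpull : ∫ x in Ioi (0:ℝ), c (t + x) * (θ * exp (-θ * x)) =
      θ * ∫ x in Ioi (0:ℝ), c (t + x) * exp (-θ * x) := by
    rw [← integral_const_mul]
    simp only [mul_left_comm]
  have hsum : IntegrableOn (fun x => θ * (c (t + x) * exp (-θ * x)) +
      (lam * θ * ∫ s in (0:ℝ)..t, c s) * exp (-θ * x)) (Ioi 0) :=
    (hshift.const_mul _).add (hexp.const_mul _)
  rw [setIntegral_congr_fun measurableSet_Ioi hsplit, integral_add hsum (hpi.const_mul _),
    integral_add (hshift.const_mul _) (hexp.const_mul _), integral_const_mul, integral_const_mul,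
    integral_const_mul, hval, hpv, hpull, hcoef, hr t ht]
  field_simp
  ring
end

section
/- Let λ, μ, α > 0, let γ ∈ (0,1) satisfy γ·(μ + α + λ − λγ) = μ, and set θ := α/(1−γ) and γ₂ := λ/(λ+α). Let c : [0,∞) → ℝ be continuously differentiable and nondecreasing with ∫_0^∞ c(u) e^{−θu} du < ∞. Define r(t) := c(t) + λ∫_0^t c(x)dx for t ≥ 0 and r(t) := 0 for t < 0, and set Cb(t) := (1−γ) ∫_0^∞ r(t+s) θe^{−θs} ds and Γ(t) := (α/(α+λ)) ∫_0^∞ λ e^{−λy} r(t−y) dy. Then Cb and Γ are differentiable on (0,∞), and for every t > 0: (1/(1−γ)) · [ α(1−γγ₂) r(t) + Cb'(t) − α Cb(t) + γ Γ'(t) − α γ Γ(t) ] = μ ∫_0^∞ c(t+x) θe^{−θx} dx. -/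
open MeasureTheory Real Set

open Filter Topology

theorem hasDerivAt_primitive {g : ℝ → ℝ} (hg : Continuous g) (t : ℝ) :
    HasDerivAt (fun u => ∫ x in (0:ℝ)..u, g x) (g t) t :=
  intervalIntegral.integral_hasDerivAt_right (hg.intervalIntegrable _ _)
    (hg.stronglyMeasurableAtFilter _ _) hg.continuousAt

theorem hasDerivAt_exp_mul (a t : ℝ) :
    HasDerivAt (fun u => exp (a * u)) (a * exp (a * t)) t := by
  simpa [mul_comm] using ((hasDerivAt_id t).const_mul a).exp

theorem setIntegral_Ioi_comp_add_left (f : ℝ → ℝ) (t : ℝ) :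
    ∫ s in Ioi (0:ℝ), f (t + s) = ∫ u in Ioi t, f u := by
  have h := (measurePreserving_add_left (volume : Measure ℝ) t).setIntegral_preimage_emb
    (measurableEmbedding_addLeft t) f (Ioi t)
  simpa using h

/-- Shifting the exponential weight. -/
theorem setIntegral_Ioi_exp_shift (f : ℝ → ℝ) (t a : ℝ) :
    ∫ s in Ioi (0:ℝ), f (t + s) * (a * exp (-a * s)) =
      a * exp (a * t) * ∫ u in Ioi t, f u * exp (-a * u) := by
  rw [← setIntegral_Ioi_comp_add_left (fun u => f u * exp (-a * u)) t, ← integral_const_mul]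
  refine integral_congr_ae (ae_of_all _ fun s => ?_)
  have : exp (-a * s) = exp (a * t) * exp (-a * (t + s)) := by
    rw [← exp_add]; ring_nf
  simp only [this]
  ring

section Laplace

variable {g : ℝ → ℝ} {a : ℝ}

theorem tendsto_primitive_mul_exp_atTop (ha : 0 < a)
    (hint : IntegrableOn (fun u => g u * exp (-a * u)) (Ioi 0)) (hg : Continuous g) :
    Tendsto (fun u => (∫ x in (0:ℝ)..u, g x) * exp (-a * u)) atTop (𝓝 0) := by
  have key : Tendsto (fun u : ℝ => ∫ x in Ioi (0:ℝ),
      (Iic u).indicator (fun x => g x * exp (-a * u)) x) atTop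
      (𝓝 (∫ _ in Ioi (0:ℝ), (0:ℝ))) := by
    refine tendsto_integral_filter_of_dominated_convergence
      (fun x => ‖g x * exp (-a * x)‖) (Eventually.of_forall fun u => ?_)
      (Eventually.of_forall fun u => ae_of_all _ fun x => ?_) hint.norm
      (ae_of_all _ fun x => ?_)
    · exact ((hg.mul continuous_const).aestronglyMeasurable).indicator measurableSet_Iic
    · by_cases hx : x ∈ Iic u
      · rw [indicator_of_mem hx, norm_mul, norm_mul]
        have hx' : x ≤ u := hx
        refine mul_le_mul_of_nonneg_left ?_ (norm_nonneg _)
        rw [norm_of_nonneg (exp_pos _).le, norm_of_nonneg (exp_pos _).le]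
        exact exp_le_exp.2 (by nlinarith)
      · rw [indicator_of_notMem hx, norm_zero]
        exact norm_nonneg _
    · have h1 : Tendsto (fun u : ℝ => g x * exp (-a * u)) atTop (𝓝 (g x * 0)) :=
        (tendsto_exp_atBot.comp
          (tendsto_id.const_mul_atTop_of_neg (neg_lt_zero.2 ha))).const_mul _
      rw [mul_zero] at h1
      refine h1.congr' ?_
      filter_upwards [eventually_ge_atTop x] with u hu
      rw [indicator_of_mem (show x ∈ Iic u from hu)]
  rw [integral_zero] at key
  refine key.congr' ?_
  filter_upwards [eventually_ge_atTop 0] with u hu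
  rw [setIntegral_indicator measurableSet_Iic, Ioi_inter_Iic, integral_mul_const,
    intervalIntegral.integral_of_le hu]

theorem hasDerivAt_primitive_mul_exp (ha : 0 < a) (hg : Continuous g) (t : ℝ) :
    HasDerivAt (fun u => ((∫ x in (0:ℝ)..u, g x * exp (-a * x)) -
      (∫ x in (0:ℝ)..u, g x) * exp (-a * u)) / a)
      ((∫ x in (0:ℝ)..t, g x) * exp (-a * t)) t := by
  have h1 := hasDerivAt_primitive (g := fun x => g x * exp (-a * x)) (by fun_prop) t
  have h2 := (hasDerivAt_primitive hg t).mul (hasDerivAt_exp_mul (-a) t)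
  refine ((h1.sub h2).div_const a).congr_deriv ?_
  rw [div_eq_iff ha.ne']
  ring

theorem tendsto_primitive_sub_primitive_mul_exp_atTop (ha : 0 < a)
    (hint : IntegrableOn (fun u => g u * exp (-a * u)) (Ioi 0)) (hg : Continuous g) :
    Tendsto (fun u => ((∫ x in (0:ℝ)..u, g x * exp (-a * x)) -
      (∫ x in (0:ℝ)..u, g x) * exp (-a * u)) / a) atTop
      (𝓝 ((∫ x in Ioi (0:ℝ), g x * exp (-a * x)) / a)) := by
  have h := ((intervalIntegral_tendsto_integral_Ioi 0 hint tendsto_id).sub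
    (tendsto_primitive_mul_exp_atTop ha hint hg)).div_const a
  simpa only [sub_zero, id] using h

theorem integrableOn_primitive_mul_exp (ha : 0 < a)
    (hint : IntegrableOn (fun u => g u * exp (-a * u)) (Ioi 0)) (hg : Continuous g) :
    IntegrableOn (fun u => (∫ x in (0:ℝ)..u, g x) * exp (-a * u)) (Ioi 0) := by
  have hint' : IntegrableOn (fun u => |g u| * exp (-a * u)) (Ioi 0) := by
    simpa [IntegrableOn, abs_mul, abs_of_pos (exp_pos _)] using hint.abs
  have hD : IntegrableOn (fun u => (∫ x in (0:ℝ)..u, |g x|) * exp (-a * u)) (Ioi 0) :=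
    integrableOn_Ioi_deriv_of_nonneg'
      (fun x _ => hasDerivAt_primitive_mul_exp ha hg.abs x)
      (fun x hx => mul_nonneg
        (intervalIntegral.integral_nonneg (le_of_lt hx) fun _ _ => abs_nonneg _) (exp_pos _).le)
      (tendsto_primitive_sub_primitive_mul_exp_atTop ha hint' hg.abs)
  have hG : Continuous fun u => ∫ x in (0:ℝ)..u, g x :=
    continuous_iff_continuousAt.2 fun t => (hasDerivAt_primitive hg t).continuousAt
  refine Integrable.mono' hD (by fun_prop : Continuous fun u =>
    (∫ x in (0:ℝ)..u, g x) * exp (-a * u)).aestronglyMeasurable ?_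
  filter_upwards [ae_restrict_mem measurableSet_Ioi] with u hu
  rw [norm_mul, norm_of_nonneg (exp_pos _).le]
  exact mul_le_mul_of_nonneg_right
    (intervalIntegral.abs_integral_le_integral_abs (le_of_lt hu)) (exp_pos _).le

theorem setIntegral_Ioi_eq_sub_primitive {h : ℝ → ℝ} {t : ℝ} (ht : 0 ≤ t)
    (hint : IntegrableOn h (Ioi 0)) :
    ∫ u in Ioi t, h u = (∫ u in Ioi (0:ℝ), h u) - ∫ u in (0:ℝ)..t, h u := by
  rw [← intervalIntegral.integral_interval_add_Ioi hint (hint.mono_set (Ioi_subset_Ioi ht))]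
  ring

/-- Integration by parts for the tail Laplace integral of a primitive. -/
theorem setIntegral_primitive_mul_exp (ha : 0 < a)
    (hint : IntegrableOn (fun u => g u * exp (-a * u)) (Ioi 0)) (hg : Continuous g)
    {t : ℝ} (ht : 0 ≤ t) :
    ∫ u in Ioi t, (∫ x in (0:ℝ)..u, g x) * exp (-a * u) =
      ((∫ u in Ioi t, g u * exp (-a * u)) + (∫ x in (0:ℝ)..t, g x) * exp (-a * t)) / a := by
  rw [integral_Ioi_of_hasDerivAt_of_tendsto' (fun x _ => hasDerivAt_primitive_mul_exp ha hg x)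
    ((integrableOn_primitive_mul_exp ha hint hg).mono_set (Ioi_subset_Ioi ht))
    (tendsto_primitive_sub_primitive_mul_exp_atTop ha hint hg),
    setIntegral_Ioi_eq_sub_primitive ht hint]
  ring

theorem hasDerivAt_exp_mul_tail
    (hint : IntegrableOn (fun u => g u * exp (-a * u)) (Ioi 0)) (hg : Continuous g)
    {t : ℝ} (ht : 0 < t) :
    HasDerivAt (fun t => exp (a * t) * ∫ u in Ioi t, g u * exp (-a * u))
      (a * (exp (a * t) * ∫ u in Ioi t, g u * exp (-a * u)) - g t) t := by
  have h1 := hasDerivAt_primitive (g := fun x => g x * exp (-a * x)) (by fun_prop) t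
  have h2 := (hasDerivAt_exp_mul a t).mul
    (h1.const_sub (∫ u in Ioi (0:ℝ), g u * exp (-a * u)))
  refine HasDerivAt.congr_of_eventuallyEq (HasDerivAt.congr_deriv h2 ?_) ?_
  · rw [setIntegral_Ioi_eq_sub_primitive ht.le hint]
    have : exp (a * t) * exp (-a * t) = 1 := by rw [← exp_add]; simp
    linear_combination (-g t) * this
  · filter_upwards [eventually_gt_nhds ht] with s hs
    rw [setIntegral_Ioi_eq_sub_primitive (le_of_lt hs) hint]
    rfl

end Laplace

/-- Exponential convolution inverts the operator `G ↦ G' + b G`. -/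
theorem intervalIntegral_exp_conv {g : ℝ → ℝ} (hg : Continuous g) (b t : ℝ) :
    ∫ y in (0:ℝ)..t, b * exp (-b * y) * (g (t - y) + b * ∫ x in (0:ℝ)..(t - y), g x) =
      b * ∫ x in (0:ℝ)..t, g x := by
  have hG : Continuous fun u => ∫ x in (0:ℝ)..u, g x :=
    continuous_iff_continuousAt.2 fun t => (hasDerivAt_primitive hg t).continuousAt
  have hd : ∀ y ∈ uIcc 0 t, HasDerivAt
      (fun y => -b * (exp (-b * y) * ∫ x in (0:ℝ)..(t - y), g x))
      (b * exp (-b * y) * (g (t - y) + b * ∫ x in (0:ℝ)..(t - y), g x)) y := by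
    intro y _
    have h1 := (hasDerivAt_primitive hg (t - y)).comp y ((hasDerivAt_id y).const_sub t)
    have h2 := ((hasDerivAt_exp_mul (-b) y).mul h1).const_mul (-b)
    refine HasDerivAt.congr_deriv h2 ?_
    simp only [Function.comp]
    ring
  have hG' : Continuous fun y => ∫ x in (0:ℝ)..(t - y), g x :=
    hG.comp (continuous_const.sub continuous_id)
  rw [intervalIntegral.integral_eq_sub_of_hasDerivAt hd
    (Continuous.intervalIntegrable (by fun_prop) _ _)]
  simp

/-- Paper's Lemma 4.13: the guessed Whittle index formula of Lemma 4.11,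
expressed via `Cb(t) = (1−γ)E[r(t+X)]` and `Γ(t) = (α/(α+λ))E[r(t−T₂)]`,
simplifies to `μ E[c(t+X)]` with `X ~ Exp(θ)`, `θ = α/(1−γ)`. -/
theorem guessed_whittle_index_simplification
    (lam mu alpha gamma : ℝ) (hlam : 0 < lam) (hmu : 0 < mu) (halpha : 0 < alpha)
    (hg0 : 0 < gamma) (hg1 : gamma < 1)
    (hfix : gamma * (mu + alpha + lam - lam * gamma) = mu)
    (θ γ₂ : ℝ) (hθ : θ = alpha / (1 - gamma)) (hγ₂ : γ₂ = lam / (lam + alpha))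
    (c c' : ℝ → ℝ)
    (hderiv : ∀ x ∈ Ici (0:ℝ), HasDerivWithinAt c (c' x) (Ici 0) x)
    (hc' : ContinuousOn c' (Ici 0)) (hmono : MonotoneOn c (Ici 0))
    (hint : IntegrableOn (fun u => c u * exp (-θ * u)) (Ici 0))
    (r : ℝ → ℝ)
    (hr : ∀ u, r u = if 0 ≤ u then c u + lam * ∫ x in (0:ℝ)..u, c x else 0)
    (Cb Γ : ℝ → ℝ)
    (hCb : ∀ t, Cb t = (1 - gamma) * ∫ s in Ioi (0:ℝ), r (t + s) * (θ * exp (-θ * s)))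
    (hΓ : ∀ t, Γ t = alpha / (alpha + lam) *
        ∫ y in Ioi (0:ℝ), lam * exp (-lam * y) * r (t - y)) :
    DifferentiableOn ℝ Cb (Ioi 0) ∧ DifferentiableOn ℝ Γ (Ioi 0) ∧
      ∀ t ∈ Ioi (0:ℝ),
        1 / (1 - gamma) *
            (alpha * (1 - gamma * γ₂) * r t + deriv Cb t - alpha * Cb t
              + gamma * deriv Γ t - alpha * gamma * Γ t) =
          mu * ∫ x in Ioi (0:ℝ), c (t + x) * (θ * exp (-θ * x)) := by
  have hθ0 : 0 < θ := hθ ▸ div_pos halpha (by linarith)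
  have hg1' : (1 - gamma) ≠ 0 := by linarith
  obtain ⟨g, hgdef⟩ : ∃ g : ℝ → ℝ, g = fun x => c (max x 0) := ⟨_, rfl⟩
  have hgc : ∀ x, 0 ≤ x → g x = c x := fun x hx => by rw [hgdef]; simp [hx]
  have hg : Continuous g := by
    have hc : ContinuousOn c (Ici 0) := fun x hx => (hderiv x hx).continuousWithinAt
    rw [hgdef]
    exact hc.comp_continuous (by fun_prop) fun x => le_max_right x 0
  have hint' : IntegrableOn (fun u => g u * exp (-θ * u)) (Ioi 0) :=
    (hint.mono_set Ioi_subset_Ici_self).congr_fun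
      (fun u hu => by simp only [hgc u (le_of_lt hu)]) measurableSet_Ioi
  have hrg : ∀ u, 0 ≤ u → r u = g u + lam * ∫ x in (0:ℝ)..u, g x := by
    intro u hu
    rw [hr, if_pos hu, hgc u hu]
    congr 2
    refine intervalIntegral.integral_congr fun x hx => ?_
    rw [uIcc_of_le hu] at hx
    exact (hgc x hx.1).symm
  have hΓ' : ∀ t, 0 < t → Γ t = alpha / (alpha + lam) * (lam * ∫ x in (0:ℝ)..t, g x) := by
    intro t ht
    rw [hΓ, ← intervalIntegral_exp_conv hg lam t, intervalIntegral.integral_of_le ht.le]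
    congr 1
    rw [setIntegral_eq_of_subset_of_forall_sdiff_eq_zero measurableSet_Ioi
      (Ioc_subset_Ioi_self : Ioc 0 t ⊆ Ioi 0)]
    · refine setIntegral_congr_fun measurableSet_Ioc fun y hy => ?_
      simp only [hrg (t - y) (by linarith [hy.2])]
    · intro y hy
      have hy' : ¬ 0 ≤ t - y := fun h => hy.2 ⟨hy.1, by linarith⟩
      rw [hr, if_neg hy', mul_zero]
  have hCb' : ∀ t, 0 < t → Cb t = (alpha + lam * (1 - gamma)) *
      (exp (θ * t) * ∫ u in Ioi t, g u * exp (-θ * u)) +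
      lam * (1 - gamma) * ∫ x in (0:ℝ)..t, g x := by
    intro t ht
    have hsplit : ∫ u in Ioi t, r u * exp (-θ * u) =
        (∫ u in Ioi t, g u * exp (-θ * u)) +
          lam * ∫ u in Ioi t, (∫ x in (0:ℝ)..u, g x) * exp (-θ * u) := by
      rw [← integral_const_mul, ← integral_add (hint'.mono_set (Ioi_subset_Ioi ht.le))
        (((integrableOn_primitive_mul_exp hθ0 hint' hg).mono_set
          (Ioi_subset_Ioi ht.le)).const_mul lam)]
      refine setIntegral_congr_fun measurableSet_Ioi fun u hu => ?_
      simp only [hrg u (ht.le.trans (le_of_lt hu))]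
      ring
    rw [hCb, setIntegral_Ioi_exp_shift, hsplit, setIntegral_primitive_mul_exp hθ0 hint' hg ht.le]
    have he : exp (θ * t) * exp (-θ * t) = 1 := by rw [← exp_add]; simp
    have ha : alpha = θ * (1 - gamma) := by rw [hθ]; field_simp
    rw [neg_mul] at he
    rw [ha]
    field_simp
    linear_combination lam * (∫ x in (0:ℝ)..t, g x) * he
  have hdΓ : ∀ t, 0 < t → HasDerivAt Γ (alpha / (alpha + lam) * (lam * g t)) t := by
    intro t ht
    refine (((hasDerivAt_primitive hg t).const_mul lam).const_mul _).congr_of_eventuallyEq ?_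
    filter_upwards [eventually_gt_nhds ht] with s hs using hΓ' s hs
  have hdCb : ∀ t, 0 < t → HasDerivAt Cb ((alpha + lam * (1 - gamma)) *
      (θ * (exp (θ * t) * ∫ u in Ioi t, g u * exp (-θ * u)) - g t) +
      lam * (1 - gamma) * g t) t := by
    intro t ht
    refine (((hasDerivAt_exp_mul_tail hint' hg ht).const_mul _).add
      ((hasDerivAt_primitive hg t).const_mul _)).congr_of_eventuallyEq ?_
    filter_upwards [eventually_gt_nhds ht] with s hs using hCb' s hs
  refine ⟨fun t ht => (hdCb t ht).differentiableAt.differentiableWithinAt,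
    fun t ht => (hdΓ t ht).differentiableAt.differentiableWithinAt, fun t ht => ?_⟩
  have ht0 : 0 < t := ht
  have hR : ∫ x in Ioi (0:ℝ), c (t + x) * (θ * exp (-θ * x)) =
      θ * exp (θ * t) * ∫ u in Ioi t, g u * exp (-θ * u) := by
    rw [← setIntegral_Ioi_exp_shift]
    refine setIntegral_congr_fun measurableSet_Ioi fun x hx => ?_
    simp only [hgc (t + x) (add_pos ht0 hx).le]
  rw [hR, (hdCb t ht0).deriv, (hdΓ t ht0).deriv, hCb' t ht0, hΓ' t ht0, hrg t ht0.le, hγ₂]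
  generalize (∫ u in Ioi t, g u * exp (-θ * u)) = J
  generalize (∫ x in (0:ℝ)..t, g x) = G
  have ha : alpha = θ * (1 - gamma) := by rw [hθ]; field_simp
  have hfix' : gamma * (alpha + lam * (1 - gamma)) = mu * (1 - gamma) := by
    linear_combination hfix
  have hE : (alpha + lam * (1 - gamma)) * (θ - alpha) = mu * θ * (1 - gamma) := by
    linear_combination θ * hfix' - (alpha + lam * (1 - gamma)) * ha
  rw [div_mul_eq_mul_div, one_mul, div_eq_iff hg1', add_comm alpha lam]
  field_simp
  linear_combination (lam + alpha) * exp (θ * t) * J * hE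
end

section
/- Let 0 < λ < μ and t₀ ≥ 0. Let c : [0,∞) → [0,∞) be continuous and nondecreasing, and suppose there exist C ≥ 0 and 0 ≤ κ < μ−λ such that c(u) ≤ C e^{κu} for all u ≥ 0. For α > 0 let γ(α) := ( (μ+λ+α) − √( (μ+λ+α)² − 4λμ ) ) / (2λ) and θ(α) := α/(1−γ(α)). Then lim_{α→0⁺} μ ∫_0^∞ c(t₀+x) θ(α) e^{−θ(α)x} dx = μ ∫_0^∞ c(t₀+x) (μ−λ) e^{−(μ−λ)x} dx. -/
open MeasureTheory Real Set

/-- The expectation of a function of at most exponential growth rate `κ` under the exponential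
distribution is continuous in its rate `r`, at every rate `L > κ`. -/
theorem continuousAt_integral_mul_exponential_density {f : ℝ → ℝ} {K κ L : ℝ}
    (hf : AEStronglyMeasurable f (volume.restrict (Ioi 0)))
    (hbound : ∀ x ∈ Ioi (0 : ℝ), |f x| ≤ K * exp (κ * x)) (hL : κ < L) :
    ContinuousAt (fun r => ∫ x in Ioi (0 : ℝ), f x * (r * exp (-r * x))) L := by
  obtain ⟨m, hκm, hmL⟩ := exists_between hL
  refine continuousAt_of_dominated
    (bound := fun x => K * (|L| + 1) * exp (-(m - κ) * x)) ?_ ?_ ?_ ?_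
  · exact .of_forall fun r => hf.mul
      (by fun_prop : Continuous fun x : ℝ => r * exp (-r * x)).aestronglyMeasurable
  · have habs : ∀ᶠ r in nhds L, |r| < |L| + 1 :=
      continuous_abs.continuousAt.eventually_lt_const (lt_add_one _)
    filter_upwards [eventually_gt_nhds hmL, habs] with r hmr hr
    refine (ae_restrict_iff' measurableSet_Ioi).2 (.of_forall fun x hx => ?_)
    have hx0 : (0 : ℝ) < x := hx
    have hexp : exp (-r * x) ≤ exp (-m * x) := exp_le_exp.2 (by nlinarith)
    rw [norm_mul, norm_mul, norm_eq_abs, norm_eq_abs, norm_eq_abs, abs_exp]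
    calc |f x| * (|r| * exp (-r * x))
        ≤ (K * exp (κ * x)) * ((|L| + 1) * exp (-m * x)) :=
          mul_le_mul (hbound x hx) (mul_le_mul hr.le hexp (exp_pos _).le (by positivity))
            (by positivity) ((abs_nonneg _).trans (hbound x hx))
      _ = K * (|L| + 1) * exp (-(m - κ) * x) := by
          rw [show -(m - κ) * x = κ * x + -m * x by ring, exp_add]
          ring
  · exact (integrableOn_exp_mul_Ioi (by linarith) 0).const_mul _
  · exact .of_forall fun x => by fun_prop

/-- Rationalized form of the rate `α / (1 - γ(α))`, free of the `0 / 0` at `α = 0`. -/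
theorem div_one_sub_busyPeriodTransform_eq {lam mu a : ℝ} (hlam : 0 < lam) (hlm : lam < mu)
    (ha : 0 < a) :
    a / (1 - ((mu + lam + a) - √((mu + lam + a) ^ 2 - 4 * lam * mu)) / (2 * lam)) =
      (√((mu + lam + a) ^ 2 - 4 * lam * mu) + (mu - lam + a)) / 2 := by
  have hnonneg : 0 ≤ (mu + lam + a) ^ 2 - 4 * lam * mu := by nlinarith [sq_nonneg (mu - lam)]
  have hsq := sq_sqrt hnonneg
  have hs := sqrt_nonneg ((mu + lam + a) ^ 2 - 4 * lam * mu)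
  set s := √((mu + lam + a) ^ 2 - 4 * lam * mu)
  have hprod : (1 - ((mu + lam + a) - s) / (2 * lam)) * (s + (mu - lam + a)) = 2 * a := by
    field_simp
    linear_combination hsq
  have hne : 1 - ((mu + lam + a) - s) / (2 * lam) ≠ 0 := by
    intro h
    rw [h] at hprod
    linarith
  rw [div_eq_iff hne]
  linear_combination -hprod / 2

/-- The rate `α / (1 - γ(α))` tends to `μ - λ` as `α → 0⁺`. -/
theorem tendsto_div_one_sub_busyPeriodTransform {lam mu : ℝ} (hlam : 0 < lam) (hlm : lam < mu) :
    Filter.Tendsto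
      (fun a => a / (1 - ((mu + lam + a) - √((mu + lam + a) ^ 2 - 4 * lam * mu)) / (2 * lam)))
      (nhdsWithin 0 (Ioi 0)) (nhds (mu - lam)) := by
  have hcont : Continuous fun a : ℝ =>
      (√((mu + lam + a) ^ 2 - 4 * lam * mu) + (mu - lam + a)) / 2 := by fun_prop
  have hlim := (hcont.tendsto 0).mono_left (nhdsWithin_le_nhds (s := Ioi 0))
  have hzero : (√((mu + lam + 0) ^ 2 - 4 * lam * mu) + (mu - lam + 0)) / 2 = mu - lam := by
    rw [show (mu + lam + 0) ^ 2 - 4 * lam * mu = (mu - lam) ^ 2 by ring,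
      sqrt_sq (sub_nonneg.2 hlm.le)]
    ring
  rw [hzero] at hlim
  refine hlim.congr' ?_
  filter_upwards [self_mem_nhdsWithin] with a ha
  exact (div_one_sub_busyPeriodTransform_eq hlam hlm ha).symm

/-- Paper's Corollary 5.2: the discounted Whittle index
`Ŵ(t₀,α) = μ E[c(t₀+X_α)]`, `X_α ~ Exp(α/(1−γ(α)))`, converges as `α → 0⁺`
to the undiscounted index `μ E[c(t₀+X)]` with `X ~ Exp(μ−λ)`. -/
theorem whittle_index_discount_limit
    (lam mu : ℝ) (hlam : 0 < lam) (hlm : lam < mu) (t₀ : ℝ) (ht₀ : 0 ≤ t₀)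
    (c : ℝ → ℝ) (hc_cont : ContinuousOn c (Ici 0)) (hc_mono : MonotoneOn c (Ici 0))
    (hc_nonneg : ∀ u ∈ Ici (0:ℝ), 0 ≤ c u)
    (C κ : ℝ) (hC : 0 ≤ C) (hκ0 : 0 ≤ κ) (hκ : κ < mu - lam)
    (hbound : ∀ u ∈ Ici (0:ℝ), c u ≤ C * exp (κ * u))
    (γ θ : ℝ → ℝ)
    (hγ : ∀ alpha, γ alpha =
      ((mu + lam + alpha) - Real.sqrt ((mu + lam + alpha) ^ 2 - 4 * lam * mu)) /
        (2 * lam))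
    (hθ : ∀ alpha, θ alpha = alpha / (1 - γ alpha)) :
    Filter.Tendsto
      (fun alpha => mu * ∫ x in Ioi (0:ℝ), c (t₀ + x) * (θ alpha * exp (-(θ alpha) * x)))
      (nhdsWithin 0 (Ioi 0))
      (nhds (mu * ∫ x in Ioi (0:ℝ),
        c (t₀ + x) * ((mu - lam) * exp (-(mu - lam) * x)))) := by
  have hmem : ∀ x ∈ Ioi (0 : ℝ), t₀ + x ∈ Ici (0 : ℝ) := fun x hx =>
    add_nonneg ht₀ (mem_Ioi.1 hx).le
  have hmeas : AEStronglyMeasurable (fun x => c (t₀ + x)) (volume.restrict (Ioi 0)) :=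
    (hc_cont.comp (by fun_prop) hmem).aestronglyMeasurable measurableSet_Ioi
  have hgrowth : ∀ x ∈ Ioi (0 : ℝ), |c (t₀ + x)| ≤ C * exp (κ * t₀) * exp (κ * x) := by
    intro x hx
    rw [abs_of_nonneg (hc_nonneg _ (hmem x hx)), mul_assoc, ← exp_add, ← mul_add]
    exact hbound _ (hmem x hx)
  have hrate : Filter.Tendsto θ (nhdsWithin 0 (Ioi 0)) (nhds (mu - lam)) := by
    simpa only [funext hθ, hγ] using tendsto_div_one_sub_busyPeriodTransform hlam hlm
  exact ((continuousAt_integral_mul_exponential_density hmeas hgrowth hκ).tendsto.comp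
    hrate).const_mul mu
end

section
/- Let λ, α, θ > 0 and set γ₂ := λ/(λ+α). Let c : [0,∞) → ℝ be continuously differentiable and nondecreasing with ∫_0^∞ c(u) e^{−θu} du < ∞, and define r(t) := c(t) + λ∫_0^t c(x)dx for t ≥ 0. Then for all t₀ ≥ 0 and all 0 ≤ t ≤ t₀: (1 − e^{−α(t₀−t)}) ∫_0^∞ c(t₀+x) θe^{−θx} dx + (1−γ₂) · ( r(t) − c(t) − e^{−α(t₀−t)} ( r(t₀) − c(t₀) ) ) ≥ (1−γ₂) ∫_0^{t₀−t} α r(t+s) e^{−αs} ds. -/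
open MeasureTheory Real Set

/-- Integration by parts for the discounted integral of a primitive. -/
lemma integral_primitive_mul_exp_neg_s16 {f : ℝ → ℝ} (hf : Continuous f) (lam a t d : ℝ) :
    ∫ s in (0:ℝ)..d, a * (f (t + s) + lam * ∫ x in (0:ℝ)..(t + s), f x) * exp (-a * s) =
      (lam + a) * (∫ s in (0:ℝ)..d, f (t + s) * exp (-a * s)) +
        (lam * (∫ x in (0:ℝ)..t, f x) - exp (-a * d) * (lam * ∫ x in (0:ℝ)..(t + d), f x)) := by
  have hA : ∀ s, HasDerivAt (fun s => ∫ x in (0:ℝ)..(t + s), f x) (f (t + s)) s := fun s => by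
    have h := (hf.integral_hasStrictDerivAt 0 (t + s)).hasDerivAt
    simpa using h.comp_const_add t s
  have hE : ∀ s, HasDerivAt (fun s => exp (-a * s)) (exp (-a * s) * -a) s := fun s => by
    simpa using ((hasDerivAt_id s).const_mul (-a)).exp
  have hAc : Continuous fun s => ∫ x in (0:ℝ)..(t + s), f x :=
    continuous_iff_continuousAt.2 fun s => (hA s).continuousAt
  have hF := intervalIntegral.integral_eq_sub_of_hasDerivAt (a := 0) (b := d)
    (fun s _ => ((hE s).mul ((hA s).const_mul lam)))
    (Continuous.intervalIntegrable (by fun_prop) _ _)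
  have hsub : ∫ s in (0:ℝ)..d,
        a * (f (t + s) + lam * ∫ x in (0:ℝ)..(t + s), f x) * exp (-a * s) =
      ∫ s in (0:ℝ)..d, ((lam + a) * (f (t + s) * exp (-a * s)) -
        (exp (-a * s) * -a * (lam * ∫ x in (0:ℝ)..(t + s), f x) +
          exp (-a * s) * (lam * f (t + s)))) := by
    congr 1 with s
    ring
  rw [hsub, intervalIntegral.integral_sub (Continuous.intervalIntegrable (by fun_prop) _ _)
    (Continuous.intervalIntegrable (by fun_prop) _ _), hF, intervalIntegral.integral_const_mul]
  simp
  ring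

lemma integral_mul_exp_neg (a d : ℝ) :
    ∫ s in (0:ℝ)..d, a * exp (-a * s) = 1 - exp (-a * d) := by
  have hE : ∀ s, HasDerivAt (fun s => -exp (-a * s)) (a * exp (-a * s)) s := fun s => by
    have h := ((hasDerivAt_id s).const_mul (-a)).exp.fun_neg
    simpa [mul_comm] using h
  rw [intervalIntegral.integral_eq_sub_of_hasDerivAt (fun s _ => hE s)
    (Continuous.intervalIntegrable (by fun_prop) _ _)]
  simp
  ring

/-- A nondecreasing cost is at most its mean after an exponential delay. -/
lemma MonotoneOn.le_integral_exp_delay {c : ℝ → ℝ} (hmono : MonotoneOn c (Ici 0)) {θ : ℝ}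
    (hθ : 0 < θ) (hint : IntegrableOn (fun u => c u * exp (-θ * u)) (Ici 0)) {u : ℝ}
    (hu : 0 ≤ u) :
    c u ≤ ∫ x in Ioi (0:ℝ), c (u + x) * (θ * exp (-θ * x)) := by
  have hone : ∫ x in Ioi (0:ℝ), θ * exp (-θ * x) = 1 := by
    rw [integral_const_mul, integral_exp_mul_Ioi (by linarith)]
    simp [hθ.ne']
  have hshift : IntegrableOn (fun x => c (u + x) * (θ * exp (-θ * x))) (Ioi 0) := by
    have h1 : IntegrableOn (fun v => c v * exp (-θ * v)) (Ioi (0 + u)) :=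
      hint.mono_set fun v hv => by
        simp only [mem_Ioi, mem_Ici] at *
        linarith
    rw [← (measurePreserving_add_right volume u).integrableOn_comp_preimage
      (measurableEmbedding_addRight u), preimage_add_const_Ioi, add_sub_cancel_right] at h1
    refine (h1.const_mul (θ * exp (θ * u))).congr (ae_of_all _ fun x => ?_)
    have : exp (-θ * x) = exp (θ * u) * exp (-θ * (x + u)) := by
      rw [← exp_add]
      ring_nf
    simp only [this, add_comm u x, Function.comp_apply]
    ring
  calc c u = ∫ x in Ioi (0:ℝ), c u * (θ * exp (-θ * x)) := by
        rw [integral_const_mul, hone, mul_one]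
    _ ≤ _ := by
        refine setIntegral_mono_on ?_ hshift measurableSet_Ioi fun x hx => ?_
        · exact ((integrableOn_exp_mul_Ioi (by linarith) 0).const_mul θ).const_mul (c u)
        · have hx' : 0 < x := hx
          exact mul_le_mul_of_nonneg_right
            (hmono hu (add_nonneg hu hx'.le) (by linarith)) (by positivity)

/-- Inequality (45) of the paper's Appendix E (HJB verification, Case 1: states
`t ≤ t₀`), the key step in proving that `Threshold(t₀)` is optimal under the
compensation `ℓ = μE[c(t₀+X)]`, `X ~ Exp(θ)`. -/
theorem hjb_case_one_inequality
    (lam alpha θ : ℝ) (hlam : 0 < lam) (halpha : 0 < alpha) (hθ : 0 < θ)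
    (γ₂ : ℝ) (hγ₂ : γ₂ = lam / (lam + alpha))
    (c c' : ℝ → ℝ)
    (hderiv : ∀ x ∈ Ici (0:ℝ), HasDerivWithinAt c (c' x) (Ici 0) x)
    (hc' : ContinuousOn c' (Ici 0)) (hmono : MonotoneOn c (Ici 0))
    (hint : IntegrableOn (fun u => c u * exp (-θ * u)) (Ici 0))
    (r : ℝ → ℝ)
    (hr : ∀ u ∈ Ici (0:ℝ), r u = c u + lam * ∫ x in (0:ℝ)..u, c x)
    (t₀ t : ℝ) (ht : 0 ≤ t) (htt₀ : t ≤ t₀) :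
    (1 - exp (-alpha * (t₀ - t))) * (∫ x in Ioi (0:ℝ), c (t₀ + x) * (θ * exp (-θ * x)))
        + (1 - γ₂) * (r t - c t - exp (-alpha * (t₀ - t)) * (r t₀ - c t₀)) ≥
      (1 - γ₂) * ∫ s in (0:ℝ)..(t₀ - t), alpha * r (t + s) * exp (-alpha * s) := by
  have ht₀ : 0 ≤ t₀ := ht.trans htt₀
  have hd : 0 ≤ t₀ - t := sub_nonneg.2 htt₀
  -- extend `c` to a continuous function on the whole line
  set f : ℝ → ℝ := fun x => c (max x 0) with hf_def
  have hf : Continuous f :=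
    ContinuousOn.comp_continuous (fun x hx => (hderiv x hx).continuousWithinAt)
      (by fun_prop) fun x => le_max_right x 0
  have hfc : ∀ x, 0 ≤ x → f x = c x := fun x hx => by simp [hf_def, hx]
  have hrf : ∀ u, 0 ≤ u → r u = f u + lam * ∫ x in (0:ℝ)..u, f x := fun u hu => by
    rw [hr u hu, hfc u hu, intervalIntegral.integral_congr (g := f) fun x hx => ?_]
    rw [uIcc_of_le hu] at hx
    exact (hfc x hx.1).symm
  have hparts : ∫ s in (0:ℝ)..(t₀ - t), alpha * r (t + s) * exp (-alpha * s) =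
      (lam + alpha) * (∫ s in (0:ℝ)..(t₀ - t), f (t + s) * exp (-alpha * s)) +
        (r t - c t - exp (-alpha * (t₀ - t)) * (r t₀ - c t₀)) := by
    have h := integral_primitive_mul_exp_neg_s16 hf lam alpha t (t₀ - t)
    rw [add_sub_cancel] at h
    rw [hrf t ht, hrf t₀ ht₀, hfc t ht, hfc t₀ ht₀, add_sub_cancel_left, add_sub_cancel_left, ← h]
    refine intervalIntegral.integral_congr fun s hs => ?_
    rw [uIcc_of_le hd] at hs
    simp only [hrf (t + s) (add_nonneg ht hs.1)]
  have hbound : alpha * (∫ s in (0:ℝ)..(t₀ - t), f (t + s) * exp (-alpha * s)) ≤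
      (1 - exp (-alpha * (t₀ - t))) * c t₀ := by
    rw [← integral_mul_exp_neg, ← intervalIntegral.integral_const_mul,
      ← intervalIntegral.integral_mul_const]
    refine intervalIntegral.integral_mono_on hd
      (Continuous.intervalIntegrable (by fun_prop) _ _)
      (Continuous.intervalIntegrable (by fun_prop) _ _) fun s hs => ?_
    have hts : 0 ≤ t + s := add_nonneg ht hs.1
    have hle : f (t + s) ≤ c t₀ := by
      rw [hfc _ hts]
      exact hmono hts ht₀ (by linarith [hs.2])
    have hpos : 0 ≤ alpha * exp (-alpha * s) := by positivity
    nlinarith [mul_le_mul_of_nonneg_left hle hpos]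
  have hmean := hmono.le_integral_exp_delay hθ hint ht₀
  have hexp : 0 ≤ 1 - exp (-alpha * (t₀ - t)) :=
    sub_nonneg.2 (exp_le_one_iff.2 (by nlinarith))
  have hγ : (1 - γ₂) * (lam + alpha) = alpha := by
    rw [hγ₂]
    field_simp
    ring
  rw [hparts, mul_add, ← mul_assoc, hγ]
  exact add_le_add_left (hbound.trans (mul_le_mul_of_nonneg_left hmean hexp)) _
end

section
/- Let λ, θ > 0 and 0 ≤ t₀ ≤ s, and let c : [0,∞) → ℝ be continuously differentiable and nondecreasing with ∫_0^∞ c(u) e^{−θu} du < ∞. Then λ c(s) + ((θ+λ)/θ) ∫_0^∞ c'(s+x) θe^{−θx} dx ≥ λ ∫_0^∞ c(t₀+x) θe^{−θx} dx. -/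
open MeasureTheory Real Set

open Filter Topology

/-- A monotone function integrable against `exp (-θ x)` on a half-line is `o(exp (θ x))`. -/
theorem MonotoneOn.tendsto_mul_exp_neg_atTop {g : ℝ → ℝ} {θ a : ℝ} (hθ : 0 < θ)
    (hmono : MonotoneOn g (Ici a))
    (hint : IntegrableOn (fun x => g x * exp (-θ * x)) (Ioi a)) :
    Tendsto (fun x => g x * exp (-θ * x)) atTop (𝓝 0) := by
  have hθ' : -θ < 0 := neg_lt_zero.2 hθ
  have hexp : Tendsto (fun x : ℝ => exp (-θ * x)) atTop (𝓝 0) :=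
    tendsto_exp_atBot.comp (tendsto_id.const_mul_atTop_of_neg hθ')
  have hlower : Tendsto (fun x : ℝ => g a * exp (-θ * x)) atTop (𝓝 0) := by
    simpa using hexp.const_mul (g a)
  have hupper : Tendsto (fun T : ℝ => θ * ((∫ x in Ioi a, g x * exp (-θ * x)) -
      ∫ x in a..T, g x * exp (-θ * x))) atTop (𝓝 0) := by
    simpa using ((intervalIntegral_tendsto_integral_Ioi a hint tendsto_id).const_sub
      (∫ x in Ioi a, g x * exp (-θ * x))).const_mul θ
  refine tendsto_of_tendsto_of_tendsto_of_le_of_le' hlower hupper ?_ ?_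
  · filter_upwards [eventually_ge_atTop a] with T hT
    exact mul_le_mul_of_nonneg_right (hmono self_mem_Ici hT hT) (exp_pos _).le
  · filter_upwards [eventually_ge_atTop a] with T hT
    have hintT := hint.mono_set (Ioi_subset_Ioi hT)
    have hsplit := intervalIntegral.integral_interval_add_Ioi hint hintT
    have htail : ∫ x in Ioi T, g T * exp (-θ * x) ≤ ∫ x in Ioi T, g x * exp (-θ * x) := by
      refine setIntegral_mono_on ((integrableOn_exp_mul_Ioi hθ' T).const_mul _) hintT
        measurableSet_Ioi fun x hx => ?_
      have hx' : T ≤ x := le_of_lt hx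
      exact mul_le_mul_of_nonneg_right (hmono hT (hT.trans hx') hx') (exp_pos _).le
    rw [integral_const_mul, integral_exp_mul_Ioi hθ', neg_div_neg_eq] at htail
    calc g T * exp (-θ * T) = θ * (g T * (exp (-θ * T) / θ)) := by field_simp
      _ ≤ _ := mul_le_mul_of_nonneg_left (by linarith) hθ.le

/-- Integration by parts against the exponential density, for a nondecreasing function. -/
theorem integral_deriv_mul_exp_density {g g' : ℝ → ℝ} {θ : ℝ} (hθ : 0 < θ)
    (hcont : ContinuousOn g (Ici 0)) (hderiv : ∀ x ∈ Ioi (0 : ℝ), HasDerivAt g (g' x) x)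
    (hmono : MonotoneOn g (Ici 0))
    (hint : IntegrableOn (fun x => g x * exp (-θ * x)) (Ioi 0)) :
    ∫ x in Ioi (0 : ℝ), g' x * (θ * exp (-θ * x)) =
      θ * ((∫ x in Ioi (0 : ℝ), g x * (θ * exp (-θ * x))) - g 0) := by
  set f : ℝ → ℝ := fun x => g x * exp (-θ * x) with hf
  have hfcont : ContinuousOn f (Ici 0) := hcont.mul (by fun_prop)
  have hfint (x : ℝ) (hx : 0 ≤ x) : IntegrableOn f (uIcc 0 x) := by
    rw [uIcc_of_le hx]
    exact (hfcont.mono Icc_subset_Ici_self).integrableOn_Icc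
  have hprim : ContinuousWithinAt (fun x => ∫ y in (0 : ℝ)..x, f y) (Ici 0) 0 := by
    have h := intervalIntegral.continuousOn_primitive_interval (hfint 1 zero_le_one) 0
      left_mem_uIcc
    rw [uIcc_of_le zero_le_one] at h
    exact h.mono_of_mem_nhdsWithin (Icc_mem_nhdsGE zero_lt_one)
  have hG : ∀ x ∈ Ioi (0 : ℝ), HasDerivAt (fun x => f x + θ * ∫ y in (0 : ℝ)..x, f y)
      (g' x * exp (-θ * x)) x := by
    intro x hx
    have hnhds : Ici (0 : ℝ) ∈ 𝓝 x := Ici_mem_nhds hx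
    have hexp : HasDerivAt (fun x : ℝ => exp (-θ * x)) (exp (-θ * x) * -θ) x := by
      simpa using ((hasDerivAt_id x).const_mul (-θ)).exp
    have hI : HasDerivAt (fun x => ∫ y in (0 : ℝ)..x, f y) (f x) x :=
      intervalIntegral.integral_hasDerivAt_right (hfint x (le_of_lt hx)).intervalIntegrable
        (ContinuousOn.stronglyMeasurableAtFilter isOpen_Ioi (hfcont.mono Ioi_subset_Ici_self) x hx)
        (hfcont.continuousAt hnhds)
    refine (((hderiv x hx).mul hexp).add (hI.const_mul θ)).congr_deriv ?_
    simp only [hf]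
    ring
  have hnonneg : ∀ x ∈ Ioi (0 : ℝ), 0 ≤ g' x * exp (-θ * x) := by
    intro x hx
    refine mul_nonneg ?_ (exp_pos _).le
    have hacc : AccPt x (𝓟 (Ioi (0 : ℝ))) :=
      uniqueDiffWithinAt_iff_accPt.1 (uniqueDiffOn_Ioi 0 x hx)
    exact (hderiv x hx).hasDerivWithinAt.nonneg_of_monotoneOn hacc
      (hmono.mono Ioi_subset_Ici_self)
  have hlim := (hmono.tendsto_mul_exp_neg_atTop hθ hint).add
    ((intervalIntegral_tendsto_integral_Ioi 0 hint tendsto_id).const_mul θ)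
  have hkey := integral_Ioi_of_hasDerivAt_of_nonneg
    ((hfcont 0 self_mem_Ici).add (hprim.const_mul θ)) hG hnonneg hlim
  have hpull (h : ℝ → ℝ) : ∫ x in Ioi (0 : ℝ), h x * (θ * exp (-θ * x)) =
      θ * ∫ x in Ioi (0 : ℝ), h x * exp (-θ * x) := by
    rw [← integral_const_mul]
    congr with x
    ring
  rw [hpull, hpull, hkey]
  simp [hf]

/-- Exponentially weighted integrability on `[0, ∞)` is inherited by right translates. -/
theorem integrableOn_comp_add_mul_exp {c : ℝ → ℝ} {θ t : ℝ} (ht : 0 ≤ t)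
    (hint : IntegrableOn (fun u => c u * exp (-θ * u)) (Ici 0)) :
    IntegrableOn (fun x => c (t + x) * exp (-θ * x)) (Ioi 0) := by
  have h := ((measurePreserving_add_left volume t).integrableOn_comp_preimage
    (measurableEmbedding_addLeft t)).2 (hint.mono_set (Ioi_subset_Ici ht))
  simp only [preimage_const_add_Ioi, sub_self] at h
  refine (h.const_mul (exp (θ * t))).congr (ae_of_all _ fun x => ?_)
  simp only [Function.comp_apply]
  rw [mul_left_comm, ← exp_add]
  ring_nf

/-- Final inequality of Case 2 (states `t > t₀`) in the HJB verification of the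
paper's Appendix E: with `X ~ Exp(θ)`,
`λc(s) + ((θ+λ)/θ)E[c'(s+X)] ≥ λE[c(t₀+X)]` for `0 ≤ t₀ ≤ s`. -/
theorem hjb_case_two_inequality
    (lam θ : ℝ) (hlam : 0 < lam) (hθ : 0 < θ)
    (t₀ s : ℝ) (ht₀ : 0 ≤ t₀) (hts : t₀ ≤ s)
    (c c' : ℝ → ℝ)
    (hderiv : ∀ x ∈ Ici (0:ℝ), HasDerivWithinAt c (c' x) (Ici 0) x)
    (hc' : ContinuousOn c' (Ici 0)) (hmono : MonotoneOn c (Ici 0))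
    (hint : IntegrableOn (fun u => c u * exp (-θ * u)) (Ici 0)) :
    lam * c s + (θ + lam) / θ * ∫ x in Ioi (0:ℝ), c' (s + x) * (θ * exp (-θ * x)) ≥
      lam * ∫ x in Ioi (0:ℝ), c (t₀ + x) * (θ * exp (-θ * x)) := by
  have hmaps {t : ℝ} (ht : 0 ≤ t) : MapsTo (fun x : ℝ => t + x) (Ici 0) (Ici 0) :=
    fun x hx => add_nonneg ht hx
  have hs : 0 ≤ s := ht₀.trans hts
  have hints := integrableOn_comp_add_mul_exp hs hint
  have hintt := integrableOn_comp_add_mul_exp ht₀ hint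
  have hcont : ContinuousOn c (Ici 0) := fun x hx => (hderiv x hx).continuousWithinAt
  have hmonos : MonotoneOn (fun x => c (s + x)) (Ici 0) := fun x hx y hy hxy =>
    hmono (hmaps hs hx) (hmaps hs hy) (add_le_add_right hxy s)
  have hparts := integral_deriv_mul_exp_density (g := fun x => c (s + x))
    (g' := fun x => c' (s + x)) hθ (hcont.comp (by fun_prop) (hmaps hs))
    (fun x hx => HasDerivAt.comp_const_add s x
      ((hderiv (s + x) (hmaps hs (Ioi_subset_Ici_self hx))).hasDerivAt
        (Ici_mem_nhds (add_pos_of_nonneg_of_pos hs hx)))) hmonos hints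
  have hdensity {h : ℝ → ℝ} (hh : IntegrableOn (fun x => h x * exp (-θ * x)) (Ioi 0)) :
      IntegrableOn (fun x => h x * (θ * exp (-θ * x))) (Ioi 0) := by
    simpa only [IntegrableOn, mul_left_comm] using hh.const_mul θ
  have hconst : IntegrableOn (fun x => c s * (θ * exp (-θ * x))) (Ioi 0) :=
    ((integrableOn_exp_mul_Ioi (neg_lt_zero.2 hθ) 0).const_mul θ).const_mul (c s)
  have hle : c s ≤ ∫ x in Ioi (0:ℝ), c (s + x) * (θ * exp (-θ * x)) := by
    have hmass : ∫ x in Ioi (0:ℝ), c s * (θ * exp (-θ * x)) = c s := by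
      rw [integral_const_mul, integral_const_mul, integral_exp_mul_Ioi (neg_lt_zero.2 hθ)]
      simp [hθ.ne']
    rw [← hmass]
    refine setIntegral_mono_on hconst (hdensity hints) measurableSet_Ioi fun x hx => ?_
    have hx' : 0 ≤ x := le_of_lt hx
    exact mul_le_mul_of_nonneg_right
      (hmono hs (hmaps hs hx') (le_add_of_nonneg_right hx')) (by positivity)
  have hle' : ∫ x in Ioi (0:ℝ), c (t₀ + x) * (θ * exp (-θ * x)) ≤
      ∫ x in Ioi (0:ℝ), c (s + x) * (θ * exp (-θ * x)) := by
    refine setIntegral_mono_on (hdensity hintt) (hdensity hints) measurableSet_Ioi fun x hx => ?_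
    have hx' : 0 ≤ x := le_of_lt hx
    exact mul_le_mul_of_nonneg_right
      (hmono (hmaps ht₀ hx') (hmaps hs hx') (add_le_add_left hts x)) (by positivity)
  rw [hparts, add_zero, ← mul_assoc, div_mul_cancel₀ _ hθ.ne']
  nlinarith [mul_le_mul_of_nonneg_left hle hθ.le, mul_le_mul_of_nonneg_left hle' hlam.le]
end

section
/- Let λ, μ, α > 0, let γ ∈ (0,1) satisfy γ·(μ + α + λ − λγ) = μ, and set θ := α/(1−γ) and γ₂ := λ/(λ+α). Let c : [0,∞) → ℝ be continuously differentiable and nondecreasing with ∫_0^∞ c(u) e^{−θu} du < ∞, define r(t) := c(t) + λ∫_0^t c(x)dx for t ≥ 0, and for t₀ ≥ 0 set ℓ := μ ∫_0^∞ c(t₀+x) θe^{−θx} dx. Then (1/(1−γγ₂)) · [ (1−γ) ∫_0^∞ r(t₀+s) θe^{−θs} ds + γ(1−γ₂)( r(t₀) − c(t₀) ) − (ℓ/α)·γ(1−γ₂) ] = r(t₀) − c(t₀) − ℓ/α + ((λ+α)/μ)·(ℓ/α). -/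
open MeasureTheory Real Set

/-- The weighted primitive of `f` is the convolution of `f x * exp (-θ x)` with the exponential
kernel on the positive half-line. -/
theorem integral_mul_exp_eq_convolution (f : ℝ → ℝ) (θ s : ℝ) :
    (∫ t in (0:ℝ)..s, ContinuousLinearMap.mul ℝ ℝ (f t * exp (-θ * t)) (exp (-θ * (s - t)))) =
      (∫ t in (0:ℝ)..s, f t) * exp (-θ * s) := by
  rw [← intervalIntegral.integral_mul_const]
  congr 1 with t
  rw [ContinuousLinearMap.mul_apply', mul_assoc, ← exp_add]
  ring_nf

theorem integrableOn_primitive_mul_exp_s19 {f : ℝ → ℝ} {θ : ℝ} (hθ : 0 < θ)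
    (hf : IntegrableOn (fun x => f x * exp (-θ * x)) (Ioi 0)) :
    IntegrableOn (fun s => (∫ x in (0:ℝ)..s, f x) * exp (-θ * s)) (Ioi 0) := by
  have h := integrable_posConvolution hf (integrableOn_exp_mul_Ioi (neg_neg_of_pos hθ) 0)
    (ContinuousLinearMap.mul ℝ ℝ)
  rw [posConvolution, integrable_indicator_iff measurableSet_Ioi] at h
  simpa only [integral_mul_exp_eq_convolution] using h

theorem integral_primitive_mul_exp {f : ℝ → ℝ} {θ : ℝ} (hθ : 0 < θ)
    (hf : IntegrableOn (fun x => f x * exp (-θ * x)) (Ioi 0)) :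
    ∫ s in Ioi (0:ℝ), (∫ x in (0:ℝ)..s, f x) * exp (-θ * s) =
      (∫ x in Ioi (0:ℝ), f x * exp (-θ * x)) / θ := by
  have h := integral_posConvolution hf (integrableOn_exp_mul_Ioi (neg_neg_of_pos hθ) 0)
    (ContinuousLinearMap.mul ℝ ℝ)
  simp only [integral_mul_exp_eq_convolution] at h
  rw [h, ContinuousLinearMap.mul_apply', integral_exp_mul_Ioi (neg_neg_of_pos hθ)]
  simp [div_eq_mul_inv]

theorem integrableOn_shift_mul_exp {f : ℝ → ℝ} {θ t : ℝ} (ht : 0 ≤ t)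
    (hf : IntegrableOn (fun x => f x * exp (-θ * x)) (Ici 0)) :
    IntegrableOn (fun x => f (t + x) * exp (-θ * x)) (Ioi 0) := by
  have h1 : IntegrableOn (fun x => f x * exp (-θ * x)) (Ioi (t + 0)) :=
    hf.mono_set fun x hx => ht.trans (by simpa using (mem_Ioi.1 hx).le)
  have h2 := ((measurePreserving_add_left volume t).integrableOn_comp_preimage
    (measurableEmbedding_addLeft t)).2 h1
  rw [preimage_const_add_Ioi, add_sub_cancel_left] at h2
  refine IntegrableOn.congr_fun (h2.const_mul (exp (θ * t))) (fun x _ => ?_) measurableSet_Ioi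
  have : exp (θ * t) * exp (-θ * (t + x)) = exp (-θ * x) := by
    rw [← exp_add]; ring_nf
  simp only [Function.comp_apply]
  rw [← this]
  ring

/-- Equation (49) of the paper's Appendix E: the value function of the threshold
policy `Threshold(t₀)` at its threshold, evaluated at the compensation
`ℓ = μE[c(t₀+X)]`, equals `r(t₀) − c(t₀) − ℓ/α + ((λ+α)/μ)(ℓ/α)`. -/
theorem value_function_at_threshold
    (lam mu alpha gamma : ℝ) (hlam : 0 < lam) (hmu : 0 < mu) (halpha : 0 < alpha)
    (hg0 : 0 < gamma) (hg1 : gamma < 1)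
    (hfix : gamma * (mu + alpha + lam - lam * gamma) = mu)
    (θ γ₂ : ℝ) (hθ : θ = alpha / (1 - gamma)) (hγ₂ : γ₂ = lam / (lam + alpha))
    (c c' : ℝ → ℝ)
    (hderiv : ∀ x ∈ Ici (0:ℝ), HasDerivWithinAt c (c' x) (Ici 0) x)
    (hc' : ContinuousOn c' (Ici 0)) (hmono : MonotoneOn c (Ici 0))
    (hint : IntegrableOn (fun u => c u * exp (-θ * u)) (Ici 0))
    (r : ℝ → ℝ)
    (hr : ∀ u ∈ Ici (0:ℝ), r u = c u + lam * ∫ x in (0:ℝ)..u, c x)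
    (t₀ : ℝ) (ht₀ : 0 ≤ t₀)
    (ℓ : ℝ) (hℓ : ℓ = mu * ∫ x in Ioi (0:ℝ), c (t₀ + x) * (θ * exp (-θ * x))) :
    1 / (1 - gamma * γ₂) *
        ((1 - gamma) * (∫ s in Ioi (0:ℝ), r (t₀ + s) * (θ * exp (-θ * s)))
          + gamma * (1 - γ₂) * (r t₀ - c t₀) - ℓ / alpha * (gamma * (1 - γ₂))) =
      r t₀ - c t₀ - ℓ / alpha + (lam + alpha) / mu * (ℓ / alpha) := by
  have h1g : 0 < 1 - gamma := sub_pos.2 hg1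
  have hθ0 : 0 < θ := hθ ▸ div_pos halpha h1g
  have hshift := integrableOn_shift_mul_exp ht₀ hint
  have hexp : IntegrableOn (fun x => exp (-θ * x)) (Ioi 0) :=
    integrableOn_exp_mul_Ioi (neg_neg_of_pos hθ0) 0
  have hprim := integrableOn_primitive_mul_exp_s19 hθ0 hshift
  have hint_exp : ∫ x in Ioi (0:ℝ), exp (-θ * x) = 1 / θ := by
    rw [integral_exp_mul_Ioi (neg_neg_of_pos hθ0)]
    simp
  have hci : ∀ a b : ℝ, 0 ≤ a → a ≤ b → IntervalIntegrable c volume a b := fun a b ha hab =>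
    (hmono.mono fun x hx => by
      rw [uIcc_of_le hab] at hx; exact ha.trans hx.1).intervalIntegrable
  have hrs : ∀ s ∈ Ioi (0:ℝ), r (t₀ + s) * (θ * exp (-θ * s)) =
      θ * (c (t₀ + s) * exp (-θ * s)) + (r t₀ - c t₀) * θ * exp (-θ * s) +
        lam * θ * ((∫ x in (0:ℝ)..s, c (t₀ + x)) * exp (-θ * s)) := by
    intro s hs
    have hs' : 0 ≤ s := (mem_Ioi.1 hs).le
    have hsplit := intervalIntegral.integral_add_adjacent_intervals
      (hci 0 t₀ le_rfl ht₀) (hci t₀ (t₀ + s) ht₀ (by linarith))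
    rw [hr _ (mem_Ici.2 (by linarith : 0 ≤ t₀ + s)), hr t₀ ht₀, ← hsplit,
      intervalIntegral.integral_comp_add_left c t₀, add_zero]
    ring
  have hE : ∫ s in Ioi (0:ℝ), r (t₀ + s) * (θ * exp (-θ * s)) =
      θ * (∫ x in Ioi (0:ℝ), c (t₀ + x) * exp (-θ * x)) + (r t₀ - c t₀) +
        lam * ∫ x in Ioi (0:ℝ), c (t₀ + x) * exp (-θ * x) := by
    have hmain := hshift.const_mul θ
    have hconst := hexp.const_mul ((r t₀ - c t₀) * θ)
    rw [setIntegral_congr_fun measurableSet_Ioi hrs,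
      integral_add (by exact hmain.add hconst) (hprim.const_mul _), integral_add hmain hconst,
      integral_const_mul,
      integral_const_mul, integral_const_mul, hint_exp, integral_primitive_mul_exp hθ0 hshift]
    field_simp
  have hℓ' : ℓ = mu * (θ * ∫ x in Ioi (0:ℝ), c (t₀ + x) * exp (-θ * x)) := by
    rw [hℓ, ← integral_const_mul θ]
    simp only [mul_left_comm]
  rw [hE, hℓ']
  generalize (∫ x in Ioi (0:ℝ), c (t₀ + x) * exp (-θ * x)) = M
  generalize r t₀ - c t₀ = R
  have hden : lam + alpha - gamma * lam ≠ 0 := by nlinarith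
  have hden' : 1 - gamma * γ₂ ≠ 0 := by
    rw [hγ₂]
    field_simp
    exact div_ne_zero hden (by positivity)
  rw [one_div, inv_mul_eq_iff_eq_mul₀ hden', hθ, hγ₂]
  have := h1g.ne'
  field_simp
  linear_combination (-(lam + alpha) * M) * hfix
end
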